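/- Let X be a random variable with density f belonging to the integrated Pearson family IP(μ; δ, β, γ) with δ ≤ 0, let n ≥ 1 and let 0 ≤ m₁ < m₂ be integers, and let g ∈ H^{m₂,n}(X). Then |Var[g(X)] − S_{m₁,n}(g)| ≥ ζ_{m₁,m₂,n}(δ) · |Var[g(X)] − S_{m₂,n}(g)|, where ζ_{m₁,m₂,n}(δ) = (m₂+n)_n ∏_{j=m₂}^{m₂+n−1}(1−jδ) / [(m₁+n)_n ∏_{j=m₁}^{m₁+n−1}(1−jδ)] > 1, with equality if and only if g coincides on the support (α, ω) of X with a polynomial of degree at most n+m₁. -/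

import Mathlib

open MeasureTheory ProbabilityTheory Finset Filter

noncomputable section

/-- Falling factorial `(x)_k = x (x-1) ⋯ (x-k+1)`, with `(x)_0 = 1`. -/
def fall (x : ℝ) (k : ℕ) : ℝ := ∏ j ∈ Finset.range k, (x - j)

/-- Rising factorial `[x]_k = x (x+1) ⋯ (x+k-1)`, with `[x]_0 = 1`. -/
def rise (x : ℝ) (k : ℕ) : ℝ := ∏ j ∈ Finset.range k, (x + j)

/-- The product `∏_{j=a}^{a+len-1} (1 - j δ)` of `len` consecutive factors
(an empty product is `1`). -/
def pp (δ a : ℝ) (len : ℕ) : ℝ := ∏ j ∈ Finset.range len, (1 - (a + j) * δ)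

/-- The open real interval with (possibly infinite) endpoints `α ω : EReal`. -/
def erealIoo (α ω : EReal) : Set ℝ := {x : ℝ | α < (x : EReal) ∧ (x : EReal) < ω}

/-- `g` coincides on `J` with a polynomial of degree at most `d`. -/
def IsPolyOn (g : ℝ → ℝ) (J : Set ℝ) (d : ℕ) : Prop :=
  ∃ p : Polynomial ℝ, p.natDegree ≤ d ∧ ∀ x ∈ J, g x = p.eval x

/-- The quadratic `q(x) = δ x² + β x + γ` of a Pearson family. -/
def pq (δ β γ : ℝ) : ℝ → ℝ := fun x => δ * x ^ 2 + β * x + γ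

/-- `P` is the distribution of a random variable with density `f` (w.r.t. Lebesgue
measure) belonging to the integrated Pearson family `IP(μ; δ, β, γ)`:
`μ` is the (finite) mean of `P`, `|δ|+|β|+|γ| > 0`, and
`∫_{-∞}^x (μ - t) f(t) dt = q(x) f(x)` for all `x`. -/
def IsIntegratedPearson (P : Measure ℝ) (f : ℝ → ℝ) (μ δ β γ : ℝ) : Prop :=
  IsProbabilityMeasure P ∧
  (∀ x, 0 ≤ f x) ∧
  P = volume.withDensity (fun x => ENNReal.ofReal (f x)) ∧
  Integrable (fun x : ℝ => x) P ∧
  μ = ∫ x, x ∂P ∧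
  0 < |δ| + |β| + |γ| ∧
  ∀ x : ℝ, (∫ t in Set.Iic x, (μ - t) * f t) = pq δ β γ x * f x

/-- Membership in the class `H^{m,n}(X)` for the distribution `P` of `X` with Pearson
quadratic `q` and support `J`.  Here `gd k` plays the role of the `k`-th derivative
`g^{(k)}` of `g = gd 0` on `J`.  With `ℓ = max m n`:  `g ∈ C^{ℓ-1}(J)`
(encoded by `gd k` having derivative `gd (k+1)` at every point of `J` for `k+1 < ℓ`,
and `gd (ℓ-1)` continuous on `J`), `g^{(ℓ-1)}` is absolutely continuous on `J` with
a.e. derivative `g^{(ℓ)} = gd ℓ` (encoded by the fundamental theorem of calculus: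
`gd ℓ` is locally integrable and `gd (ℓ-1)` is its integral on every subinterval of `J`),
and the moment conditions `E[q(X)^n (g^{(n)}(X))²] < ∞` and
`E[q(X)^i |g^{(i)}(X)|] < ∞` for `n < i ≤ m` hold. -/
def MemH (P : Measure ℝ) (q : ℝ → ℝ) (J : Set ℝ) (m n : ℕ) (gd : ℕ → ℝ → ℝ) : Prop :=
  (∀ k, k + 1 < max m n → ∀ x ∈ J, HasDerivAt (gd k) (gd (k + 1) x) x) ∧
  (1 ≤ max m n → ContinuousOn (gd (max m n - 1)) J) ∧
  (1 ≤ max m n → ∀ a ∈ J, ∀ b ∈ J,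
    IntervalIntegrable (gd (max m n)) volume a b ∧
      gd (max m n - 1) b - gd (max m n - 1) a = ∫ t in a..b, gd (max m n) t) ∧
  Integrable (fun x => q x ^ n * (gd n x) ^ 2) P ∧
  ∀ i, n < i → i ≤ m → Integrable (fun x => q x ^ i * |gd i x|) P

/-- The variance bound `S_{m,n}(g)` of Theorem 2.1, for a Pearson distribution `P`
with quadratic `q` and parameter `δ`. -/
def Sbound (P : Measure ℝ) (δ : ℝ) (q : ℝ → ℝ) (m n : ℕ) (gd : ℕ → ℝ → ℝ) : ℝ :=
  (∑ i ∈ Finset.Icc 1 m,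
      ((m.choose i : ℝ) * pp δ ((m : ℝ) + i) n /
          (fall ((m : ℝ) + n) i * (∫ x, q x ^ i ∂P) * pp δ ((i : ℝ) - 1) i *
            pp δ (m : ℝ) n)) *
        (∫ x, q x ^ i * gd i x ∂P) ^ 2) +
    ∑ i ∈ Finset.Icc 1 n,
      (-1 : ℝ) ^ (i - 1) *
          ((n.choose i : ℝ) / (fall ((m : ℝ) + n) i * pp δ (m : ℝ) i)) *
        ∫ x, q x ^ i * (gd i x) ^ 2 ∂P

/-- The comparison constant `ζ_{m₁,m₂,n}(δ)`. -/
def zeta (δ : ℝ) (m₁ m₂ n : ℕ) : ℝ :=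
  fall ((m₂ : ℝ) + n) n * pp δ (m₂ : ℝ) n / (fall ((m₁ : ℝ) + n) n * pp δ (m₁ : ℝ) n)

section A1
/-- `h` is absolutely continuous on `J` with the second function as derivative. -/
def FTC (J : Set ℝ) (h h' : ℝ → ℝ) : Prop :=
  ∀ a ∈ J, ∀ b ∈ J, IntervalIntegrable h' volume a b ∧ h b - h a = ∫ t in a..b, h' t

lemma FTC.of_hasDerivAt {J : Set ℝ} (hJ : J.OrdConnected) {h h' : ℝ → ℝ}
    (hd : ∀ x ∈ J, HasDerivAt h (h' x) x) (hc : ContinuousOn h' J) : FTC J h h' := by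
  intro a ha b hb
  have hsub : Set.uIcc a b ⊆ J := hJ.uIcc_subset ha hb
  have hii : IntervalIntegrable h' volume a b := (hc.mono hsub).intervalIntegrable
  exact ⟨hii, (intervalIntegral.integral_eq_sub_of_hasDerivAt (fun x hx => hd x (hsub hx)) hii).symm⟩

lemma FTC.ac {J : Set ℝ} (hJ : J.OrdConnected) {h h' : ℝ → ℝ} (H : FTC J h h') {a b : ℝ}
    (ha : a ∈ J) (hb : b ∈ J) : AbsolutelyContinuousOnInterval h a b ∧
      ∀ᵐ x, x ∈ Set.uIcc a b → deriv h x = h' x := by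
  have hsub : Set.uIcc a b ⊆ J := hJ.uIcc_subset ha hb
  have hii := (H a ha b hb).1
  have h1 := hii.absolutelyContinuousOnInterval_intervalIntegral (c := a) (by simp)
  have heq : ∀ x ∈ Set.uIcc a b, h x = (∫ t in a..x, h' t) + h a := by
    intro x hx
    have := (H a ha x (hsub hx)).2
    linarith
  have hcst : AbsolutelyContinuousOnInterval (fun _ : ℝ => h a) a b :=
    (contDiffOn_const).absolutelyContinuousOnInterval
  have h2 := h1.add hcst
  constructor
  · rw [absolutelyContinuousOnInterval_iff] at h2 ⊢
    intro ε hε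
    obtain ⟨d, hd, hd2⟩ := h2 ε hε
    refine ⟨d, hd, fun E hE hE2 => ?_⟩
    have := hd2 E hE hE2
    refine lt_of_le_of_lt (le_of_eq ?_) this
    refine Finset.sum_congr rfl fun i hi => ?_
    have := hE.1 i hi
    rw [heq _ this.1, heq _ this.2]
    rfl
  · have hz : ∀ᵐ x : ℝ, x ≠ a := by simp [ae_iff, measure_singleton]
    have hz' : ∀ᵐ x : ℝ, x ≠ b := by simp [ae_iff, measure_singleton]
    filter_upwards [hii.ae_hasDerivAt_integral, hz, hz'] with x hx hxa hxb hxm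
    have h3 := (hx hxm a (by simp)).add_const (h a)
    have hev : h =ᶠ[nhds x] fun y => (∫ t in a..y, h' t) + h a := by
      have : Set.uIcc a b ∈ nhds x := by
        rw [Set.uIcc] at hxm ⊢
        refine Icc_mem_nhds ?_ ?_
        · rcases lt_or_eq_of_le hxm.1 with h | h
          · exact h
          · exfalso; rcases min_choice a b with h' | h' <;> rw [h'] at h <;> first | exact hxa h.symm | exact hxb h.symm
        · rcases lt_or_eq_of_le hxm.2 with h | h
          · exact h
          · exfalso; rcases max_choice a b with h' | h' <;> rw [h'] at h <;> first | exact hxa h | exact hxb h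
      filter_upwards [this] with y hy using heq y hy
    exact (h3.congr_of_eventuallyEq hev).deriv

lemma FTC.continuousOn {J : Set ℝ} (hJ : J.OrdConnected) (hJo : IsOpen J) {h h' : ℝ → ℝ}
    (H : FTC J h h') : ContinuousOn h J := by
  intro x hx
  apply ContinuousAt.continuousWithinAt
  obtain ⟨l, u, hlu, hsub⟩ := mem_nhds_iff_exists_Ioo_subset.1 (hJo.mem_nhds hx)
  have ha : (l + x) / 2 ∈ J := hsub ⟨by linarith [hlu.1], by linarith [hlu.1, hlu.2]⟩
  have hb : (u + x) / 2 ∈ J := hsub ⟨by linarith [hlu.1, hlu.2], by linarith [hlu.2]⟩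
  have := ((H.ac hJ ha hb).1).continuousOn
  refine this.continuousAt ?_
  rw [Set.uIcc_of_le (by linarith [hlu.1, hlu.2])]
  exact Icc_mem_nhds (by linarith [hlu.1]) (by linarith [hlu.2])

lemma FTC.mul {J : Set ℝ} (hJ : J.OrdConnected) {h h' k k' : ℝ → ℝ}
    (H : FTC J h h') (K : FTC J k k') :
    FTC J (fun x => h x * k x) (fun x => h' x * k x + h x * k' x) := by
  intro a ha b hb
  obtain ⟨h1, h2⟩ := H.ac hJ ha hb
  obtain ⟨k1, k2⟩ := K.ac hJ ha hb
  have e := h1.integral_deriv_mul_eq_sub k1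
  have i1 := (H a ha b hb).1.mul_continuousOn k1.continuousOn
  have i2 := (K a ha b hb).1.continuousOn_mul h1.continuousOn
  refine ⟨i1.add i2, ?_⟩
  rw [← e]
  apply intervalIntegral.integral_congr_ae
  filter_upwards [h2, k2] with x hx hx' hxm
  have := Set.uIoc_subset_uIcc hxm
  rw [hx this, hx' this]

lemma FTC.aesm {J : Set ℝ} (hJo : IsOpen J) {h h' : ℝ → ℝ}
    (H : FTC J h h') : AEStronglyMeasurable h' (volume.restrict J) := by
  have : LocallyIntegrableOn h' J volume := by
    intro x hx
    obtain ⟨l, u, hlu, hsub⟩ := mem_nhds_iff_exists_Ioo_subset.1 (hJo.mem_nhds hx)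
    have ha : (l + x) / 2 ∈ J := hsub ⟨by linarith [hlu.1], by linarith [hlu.1, hlu.2]⟩
    have hb : (u + x) / 2 ∈ J := hsub ⟨by linarith [hlu.1, hlu.2], by linarith [hlu.2]⟩
    have := (H _ ha _ hb).1
    rw [intervalIntegrable_iff_integrableOn_Icc_of_le (by linarith [hlu.1, hlu.2])] at this
    refine ⟨_, mem_nhdsWithin_of_mem_nhds (Icc_mem_nhds ?_ ?_), this⟩
    · linarith [hlu.1]
    · linarith [hlu.2]
  exact this.aestronglyMeasurable
end A1

section A2
lemma fub_right {P : Measure ℝ} [SFinite P] {J : Set ℝ} (hJ : J.OrdConnected) (hJo : IsOpen J)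
    (hPJ : ∀ᵐ x ∂P, x ∈ J) {V U h h' : ℝ → ℝ} {c : ℝ} (hc : c ∈ J)
    (hV : Integrable V P) (hV0 : ∀ x ∈ J, c < x → 0 ≤ V x)
    (hU : ∀ t ∈ J, c < t → ∫ x in Set.Ioi t, V x ∂P = U t)
    (H : FTC J h h') (hI0 : IntegrableOn (fun t => U t * h' t) (J ∩ Set.Ioi c)) :
    IntegrableOn (fun x => V x * (h x - h c)) (Set.Ioi c) P ∧
      ∫ x in Set.Ioi c, V x * (h x - h c) ∂P = ∫ t in J ∩ Set.Ioi c, U t * h' t := by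
  set ρ := volume.restrict (J ∩ Set.Ioi c) with hρ
  have hms : MeasurableSet (J ∩ Set.Ioi c) := hJo.measurableSet.inter measurableSet_Ioi
  set S : Set (ℝ × ℝ) := {p | p.2 < p.1} with hS
  have hSm : MeasurableSet S := measurableSet_lt measurable_snd measurable_fst
  set G : ℝ × ℝ → ℝ := S.indicator (fun p => V p.1 * h' p.2) with hG
  have hh' : AEStronglyMeasurable h' ρ :=
    (H.aesm hJo).mono_measure (Measure.restrict_mono Set.inter_subset_left le_rfl)
  have hGm : AEStronglyMeasurable G (P.prod ρ) := by
    refine AEStronglyMeasurable.indicator ?_ hSm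
    exact (hV.aestronglyMeasurable.comp_fst).mul hh'.comp_snd
  have hGs : ∀ t, (fun x => G (x, t)) = (Set.Ioi t).indicator (fun x => V x * h' t) := by
    intro t; ext x
    by_cases hx : t < x
    · have : (x, t) ∈ S := hx
      rw [hG, Set.indicator_of_mem this, Set.indicator_of_mem (show x ∈ Set.Ioi t from hx)]
    · have : (x, t) ∉ S := hx
      rw [hG, Set.indicator_of_notMem this, Set.indicator_of_notMem (show x ∉ Set.Ioi t from hx)]
  have hmem : ∀ᵐ t ∂ρ, t ∈ J ∩ Set.Ioi c := ae_restrict_mem hms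
  have hGi : Integrable G (P.prod ρ) := by
    rw [integrable_prod_iff' hGm]
    constructor
    · refine ae_of_all _ fun t => ?_
      rw [hGs]
      exact (hV.mul_const _).indicator measurableSet_Ioi
    · refine (hI0.norm).congr ?_
      filter_upwards [hmem] with t ht
      have e1 : (fun x => ‖G (x, t)‖) = (Set.Ioi t).indicator (fun x => ‖V x‖ * ‖h' t‖) := by
        ext x
        have := congrFun (hGs t) x
        rw [this]
        by_cases hx : x ∈ Set.Ioi t <;> simp [hx]
      rw [e1, integral_indicator measurableSet_Ioi, integral_mul_const, norm_mul]
      congr 1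
      have e2 : ∫ x in Set.Ioi t, ‖V x‖ ∂P = ∫ x in Set.Ioi t, V x ∂P := by
        refine setIntegral_congr_ae measurableSet_Ioi ?_
        filter_upwards [hPJ] with x hx hxt
        exact Real.norm_of_nonneg (hV0 x hx (lt_trans ht.2 hxt))
      have e3 : 0 ≤ ∫ x in Set.Ioi t, V x ∂P := by
        rw [← e2]; exact integral_nonneg fun _ => norm_nonneg _
      rw [e2, hU t ht.1 ht.2] at *
      exact Real.norm_of_nonneg e3
  have hx1 : ∀ x ∈ J, ∫ t, G (x, t) ∂ρ =
      (Set.Ioi c).indicator (fun x => V x * (h x - h c)) x := by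
    intro x hx
    have e1 : (fun t => G (x, t)) = (Set.Iio x).indicator (fun t => V x * h' t) := by
      ext t
      have := congrFun (hGs t) x
      rw [this]
      by_cases hx : t < x <;> simp [hx]
    rw [e1, integral_indicator measurableSet_Iio, integral_const_mul, hρ,
      Measure.restrict_restrict measurableSet_Iio]
    by_cases hcx : c < x
    · have : Set.Iio x ∩ (J ∩ Set.Ioi c) = Set.Ioo c x := by
        ext t
        constructor
        · rintro ⟨h1, h2, h3⟩; exact ⟨h3, h1⟩
        · rintro ⟨h1, h2⟩; exact ⟨h2, hJ.out hc hx ⟨h1.le, h2.le⟩, h1⟩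
      rw [this, Set.indicator_of_mem (show x ∈ Set.Ioi c from hcx), (H c hc x hx).2,
        intervalIntegral.integral_of_le hcx.le, integral_Ioc_eq_integral_Ioo]
    · have : Set.Iio x ∩ (J ∩ Set.Ioi c) = ∅ := by
        ext t
        simp only [Set.mem_inter_iff, Set.mem_Iio, Set.mem_Ioi, Set.mem_empty_iff_false, iff_false]
        rintro ⟨h1, h2, h3⟩; exact hcx (h3.trans h1)
      rw [this, Set.indicator_of_notMem (show x ∉ Set.Ioi c from hcx)]; simp
  have hae : (fun x => ∫ t, G (x, t) ∂ρ) =ᵐ[P]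
      (Set.Ioi c).indicator (fun x => V x * (h x - h c)) := by
    filter_upwards [hPJ] with x hx using hx1 x hx
  constructor
  · rw [← integrable_indicator_iff measurableSet_Ioi]
    exact hGi.integral_prod_left.congr hae
  · rw [← integral_indicator measurableSet_Ioi, ← integral_congr_ae hae, ← integral_prod _ hGi,
      integral_prod_symm _ hGi]
    refine integral_congr_ae ?_
    filter_upwards [hmem] with t ht
    rw [hGs, integral_indicator measurableSet_Ioi, integral_mul_const, hU t ht.1 ht.2]

lemma fub_left {P : Measure ℝ} [SFinite P] {J : Set ℝ} (hJ : J.OrdConnected) (hJo : IsOpen J)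
    (hPJ : ∀ᵐ x ∂P, x ∈ J) {V U h h' : ℝ → ℝ} {c : ℝ} (hc : c ∈ J)
    (hV : Integrable V P) (hV0 : ∀ x ∈ J, x < c → V x ≤ 0)
    (hU : ∀ t ∈ J, t < c → -∫ x in Set.Iio t, V x ∂P = U t)
    (H : FTC J h h') (hI0 : IntegrableOn (fun t => U t * h' t) (J ∩ Set.Iio c)) :
    IntegrableOn (fun x => V x * (h x - h c)) (Set.Iio c) P ∧
      ∫ x in Set.Iio c, V x * (h x - h c) ∂P = ∫ t in J ∩ Set.Iio c, U t * h' t := by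
  set ρ := volume.restrict (J ∩ Set.Iio c) with hρ
  have hms : MeasurableSet (J ∩ Set.Iio c) := hJo.measurableSet.inter measurableSet_Iio
  set S : Set (ℝ × ℝ) := {p | p.1 < p.2} with hS
  have hSm : MeasurableSet S := measurableSet_lt measurable_fst measurable_snd
  set G : ℝ × ℝ → ℝ := S.indicator (fun p => V p.1 * h' p.2) with hG
  have hh' : AEStronglyMeasurable h' ρ :=
    (H.aesm hJo).mono_measure (Measure.restrict_mono Set.inter_subset_left le_rfl)
  have hGm : AEStronglyMeasurable G (P.prod ρ) := by
    refine AEStronglyMeasurable.indicator ?_ hSm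
    exact (hV.aestronglyMeasurable.comp_fst).mul hh'.comp_snd
  have hGs : ∀ t, (fun x => G (x, t)) = (Set.Iio t).indicator (fun x => V x * h' t) := by
    intro t; ext x
    by_cases hx : x < t
    · have : (x, t) ∈ S := hx
      rw [hG, Set.indicator_of_mem this, Set.indicator_of_mem (show x ∈ Set.Iio t from hx)]
    · have : (x, t) ∉ S := hx
      rw [hG, Set.indicator_of_notMem this, Set.indicator_of_notMem (show x ∉ Set.Iio t from hx)]
  have hmem : ∀ᵐ t ∂ρ, t ∈ J ∩ Set.Iio c := ae_restrict_mem hms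
  have hGi : Integrable G (P.prod ρ) := by
    rw [integrable_prod_iff' hGm]
    constructor
    · refine ae_of_all _ fun t => ?_
      rw [hGs]
      exact (hV.mul_const _).indicator measurableSet_Iio
    · refine (hI0.norm).congr ?_
      filter_upwards [hmem] with t ht
      have e1 : (fun x => ‖G (x, t)‖) = (Set.Iio t).indicator (fun x => ‖V x‖ * ‖h' t‖) := by
        ext x
        have := congrFun (hGs t) x
        rw [this]
        by_cases hx : x ∈ Set.Iio t <;> simp [hx]
      rw [e1, integral_indicator measurableSet_Iio, integral_mul_const, norm_mul]
      congr 1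
      have e2 : ∫ x in Set.Iio t, ‖V x‖ ∂P = -∫ x in Set.Iio t, V x ∂P := by
        rw [← integral_neg]
        refine setIntegral_congr_ae measurableSet_Iio ?_
        filter_upwards [hPJ] with x hx hxt
        exact Real.norm_of_nonpos (hV0 x hx (lt_trans hxt ht.2))
      have e3 : 0 ≤ -∫ x in Set.Iio t, V x ∂P := by
        rw [← e2]; exact integral_nonneg fun _ => norm_nonneg _
      rw [e2, hU t ht.1 ht.2] at *
      exact Real.norm_of_nonneg e3
  have hx1 : ∀ x ∈ J, -∫ t, G (x, t) ∂ρ =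
      (Set.Iio c).indicator (fun x => V x * (h x - h c)) x := by
    intro x hx
    have e1 : (fun t => G (x, t)) = (Set.Ioi x).indicator (fun t => V x * h' t) := by
      ext t
      have := congrFun (hGs t) x
      rw [this]
      by_cases hx : x < t <;> simp [hx]
    rw [e1, integral_indicator measurableSet_Ioi, integral_const_mul, hρ,
      Measure.restrict_restrict measurableSet_Ioi]
    by_cases hcx : x < c
    · have : Set.Ioi x ∩ (J ∩ Set.Iio c) = Set.Ioo x c := by
        ext t
        constructor
        · rintro ⟨h1, h2, h3⟩; exact ⟨h1, h3⟩
        · rintro ⟨h1, h2⟩; exact ⟨h1, hJ.out hx hc ⟨h1.le, h2.le⟩, h2⟩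
      have e := (H x hx c hc).2
      rw [intervalIntegral.integral_of_le hcx.le, integral_Ioc_eq_integral_Ioo] at e
      rw [this, Set.indicator_of_mem (show x ∈ Set.Iio c from hcx), ← e]
      ring
    · have : Set.Ioi x ∩ (J ∩ Set.Iio c) = ∅ := by
        ext t
        simp only [Set.mem_inter_iff, Set.mem_Iio, Set.mem_Ioi, Set.mem_empty_iff_false, iff_false]
        rintro ⟨h1, h2, h3⟩; exact hcx (h1.trans h3)
      rw [this, Set.indicator_of_notMem (show x ∉ Set.Iio c from hcx)]; simp
  have hae : (fun x => -∫ t, G (x, t) ∂ρ) =ᵐ[P]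
      (Set.Iio c).indicator (fun x => V x * (h x - h c)) := by
    filter_upwards [hPJ] with x hx using hx1 x hx
  constructor
  · rw [← integrable_indicator_iff measurableSet_Iio]
    exact hGi.integral_prod_left.neg.congr hae
  · rw [← integral_indicator measurableSet_Iio, ← integral_congr_ae hae, integral_neg,
      ← integral_prod _ hGi, integral_prod_symm _ hGi, ← integral_neg]
    refine integral_congr_ae ?_
    filter_upwards [hmem] with t ht
    rw [hGs, integral_indicator measurableSet_Iio, integral_mul_const, ← hU t ht.1 ht.2]
    ring

/-- Two-sided version. -/
lemma fub_full {P : Measure ℝ} [SFinite P] {J : Set ℝ} (hJ : J.OrdConnected) (hJo : IsOpen J)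
    (hPJ : ∀ᵐ x ∂P, x ∈ J) (hPv : P ≪ volume) {V U h h' : ℝ → ℝ} {c : ℝ} (hc : c ∈ J)
    (hV : Integrable V P) (hV0 : ∀ x ∈ J, c < x → 0 ≤ V x) (hV1 : ∀ x ∈ J, x < c → V x ≤ 0)
    (hVs : ∫ x, V x ∂P = 0)
    (hU : ∀ t ∈ J, ∫ x in Set.Ioi t, V x ∂P = U t)
    (H : FTC J h h') (hI0 : IntegrableOn (fun t => U t * h' t) J) :
    Integrable (fun x => V x * (h x - h c)) P ∧
      ∫ x, V x * (h x - h c) ∂P = ∫ t in J, U t * h' t := by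
  have hU' : ∀ t ∈ J, -∫ x in Set.Iio t, V x ∂P = U t := by
    intro t ht
    have e := integral_add_compl (measurableSet_Ioi (a := t)) hV
    rw [hVs, hU t ht, Set.compl_Ioi] at e
    have : ∫ x in Set.Iic t, V x ∂P = ∫ x in Set.Iio t, V x ∂P := by
      refine setIntegral_congr_set (hPv.ae_eq Iio_ae_eq_Iic.symm)
    linarith
  obtain ⟨r1, r2⟩ := fub_right hJ hJo hPJ hc hV hV0 (fun t ht _ => hU t ht) H
    (hI0.mono_set Set.inter_subset_left)
  obtain ⟨l1, l2⟩ := fub_left hJ hJo hPJ hc hV hV1 (fun t ht _ => hU' t ht) H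
    (hI0.mono_set Set.inter_subset_left)
  have l1' : IntegrableOn (fun x => V x * (h x - h c)) (Set.Iic c) P :=
    l1.congr_set_ae (hPv.ae_eq Iio_ae_eq_Iic.symm)
  have hI : Integrable (fun x => V x * (h x - h c)) P := by
    rw [← integrableOn_univ, ← Set.Iic_union_Ioi (a := c)]
    exact l1'.union r1
  refine ⟨hI, ?_⟩
  have e := integral_add_compl (measurableSet_Ioi (a := c)) hI
  rw [← e, Set.compl_Ioi, setIntegral_congr_set (hPv.ae_eq Iio_ae_eq_Iic.symm), r2, l2]
  have e3 : ∫ t in J ∩ Set.Iio c, U t * h' t = ∫ t in J ∩ Set.Iic c, U t * h' t := by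
    refine setIntegral_congr_set ?_
    exact (ae_eq_refl J).inter Iio_ae_eq_Iic
  rw [e3, ← setIntegral_union _ (hJo.measurableSet.inter measurableSet_Iic)
    (hI0.mono_set Set.inter_subset_left) (hI0.mono_set Set.inter_subset_left),
    ← Set.inter_union_distrib_left, Set.union_comm, Set.Iic_union_Ioi, Set.inter_univ]
  refine Set.disjoint_left.2 ?_
  rintro x ⟨_, h1⟩ ⟨_, h2⟩
  exact absurd (show c < x from h1) (not_lt.2 h2)
end A2

section B1
lemma aemeasurable_density {f : ℝ → ℝ} {μ δ β γ : ℝ} (hne : 0 < |δ| + |β| + |γ|)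
    (h : ∀ x : ℝ, (∫ t in Set.Iic x, (μ - t) * f t) = pq δ β γ x * f x) :
    AEMeasurable f := by
  set A : Set ℝ := {x | IntegrableOn (fun t => (μ - t) * f t) (Set.Iic x)} with hA
  have hAm : MeasurableSet A := by
    have : A.OrdConnected := by
      refine ⟨fun x _ y hy z hz => ?_⟩
      exact IntegrableOn.mono_set hy (Set.Iic_subset_Iic.2 hz.2)
    exact this.measurableSet
  set F : ℝ → ℝ := fun x => ∫ t in Set.Iic x, (μ - t) * f t with hF
  have hFm : Measurable F := by
    set F1 : ℝ → ENNReal := fun x => ∫⁻ t in Set.Iic x, ENNReal.ofReal ((μ - t) * f t) with hF1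
    set F2 : ℝ → ENNReal := fun x => ∫⁻ t in Set.Iic x, ENNReal.ofReal (-((μ - t) * f t)) with hF2
    have m1 : Measurable F1 :=
      Monotone.measurable fun a b hab => lintegral_mono_set (Set.Iic_subset_Iic.2 hab)
    have m2 : Measurable F2 :=
      Monotone.measurable fun a b hab => lintegral_mono_set (Set.Iic_subset_Iic.2 hab)
    have : F = A.indicator (fun x => (F1 x).toReal - (F2 x).toReal) := by
      ext x
      by_cases hx : x ∈ A
      · rw [Set.indicator_of_mem hx]
        exact integral_eq_lintegral_pos_part_sub_lintegral_neg_part hx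
      · rw [Set.indicator_of_notMem hx]
        exact integral_undef hx
    rw [this]
    exact (m1.ennreal_toReal.sub m2.ennreal_toReal).indicator hAm
  have hqm : Measurable (pq δ β γ) := by unfold pq; fun_prop
  refine ⟨fun x => F x / pq δ β γ x, hFm.div hqm, ?_⟩
  have hfin : {x : ℝ | pq δ β γ x = 0}.Finite := by
    set p : Polynomial ℝ := Polynomial.C δ * Polynomial.X ^ 2 + Polynomial.C β * Polynomial.X +
      Polynomial.C γ with hp
    have hp0 : p ≠ 0 := by
      intro h0
      have c0 := congrArg (fun p => Polynomial.coeff p 0) h0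
      have c1 := congrArg (fun p => Polynomial.coeff p 1) h0
      have c2 := congrArg (fun p => Polynomial.coeff p 2) h0
      simp [hp, Polynomial.coeff_X, Polynomial.coeff_C] at c0 c1 c2
      simp [c0, c1, c2] at hne
    have := p.roots.toFinset.finite_toSet
    refine this.subset fun x hx => ?_
    simp only [Finset.mem_coe, Multiset.mem_toFinset]
    rw [Polynomial.mem_roots hp0]
    simpa [hp, pq] using hx
  have : ∀ᵐ x : ℝ, x ∉ {x : ℝ | pq δ β γ x = 0} := by
    rw [ae_iff]
    simpa using hfin.measure_zero volume
  filter_upwards [this] with x hx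
  have hx' : pq δ β γ x ≠ 0 := hx
  rw [hF]
  simp only
  rw [h x]
  field_simp

lemma isOpen_erealIoo (α ω : EReal) : IsOpen (erealIoo α ω) := by
  have : erealIoo α ω = (fun x : ℝ => (x : EReal)) ⁻¹' (Set.Ioo α ω) := rfl
  rw [this]
  exact isOpen_Ioo.preimage continuous_coe_real_ereal

lemma ordConnected_erealIoo (α ω : EReal) : (erealIoo α ω).OrdConnected := by
  refine ⟨fun x hx y hy z hz => ⟨lt_of_lt_of_le hx.1 ?_, lt_of_le_of_lt ?_ hy.2⟩⟩
  · exact_mod_cast hz.1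
  · exact_mod_cast hz.2

/-- Basic facts on a Pearson distribution. -/
structure PS (P : Measure ℝ) (f : ℝ → ℝ) (μ δ β γ : ℝ) (J : Set ℝ) : Prop where
  prob : IsProbabilityMeasure P
  fnn : ∀ x, 0 ≤ f x
  fpos : ∀ x ∈ J, 0 < f x
  fzero : ∀ x, x ∉ J → f x = 0
  fm : AEMeasurable f
  Peq : P = volume.withDensity (fun x => ENNReal.ofReal (f x))
  hδ : δ ≤ 0
  Jo : IsOpen J
  Jc : J.OrdConnected
  idint : Integrable (fun x : ℝ => x) P
  mean : ∫ x, (x - μ) ∂P = 0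
  tail : ∀ t, ∫ x in Set.Ioi t, (x - μ) ∂P = pq δ β γ t * f t

section conv
variable {P : Measure ℝ} {f : ℝ → ℝ}

lemma conv_int (fm : AEMeasurable f) (fnn : ∀ x, 0 ≤ f x)
    (Peq : P = volume.withDensity (fun x => ENNReal.ofReal (f x))) (φ : ℝ → ℝ) :
    ∫ x, φ x ∂P = ∫ x, φ x * f x := by
  rw [Peq, integral_withDensity_eq_integral_toReal_smul₀ fm.ennreal_ofReal (by simp)]
  refine integral_congr_ae (ae_of_all _ fun x => ?_)
  simp [ENNReal.toReal_ofReal (fnn x), mul_comm]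

lemma conv_integrable (fm : AEMeasurable f) (fnn : ∀ x, 0 ≤ f x)
    (Peq : P = volume.withDensity (fun x => ENNReal.ofReal (f x))) (φ : ℝ → ℝ) :
    Integrable φ P ↔ Integrable (fun x => φ x * f x) volume := by
  rw [Peq, integrable_withDensity_iff_integrable_smul₀' fm.ennreal_ofReal (by simp)]
  refine integrable_congr (ae_of_all _ fun x => ?_)
  simp [ENNReal.toReal_ofReal (fnn x), mul_comm]

lemma conv_setint (fm : AEMeasurable f) (fnn : ∀ x, 0 ≤ f x)
    (Peq : P = volume.withDensity (fun x => ENNReal.ofReal (f x))) (φ : ℝ → ℝ) {s : Set ℝ}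
    (hs : MeasurableSet s) :
    ∫ x in s, φ x ∂P = ∫ x in s, φ x * f x := by
  rw [← integral_indicator hs, ← integral_indicator hs, conv_int fm fnn Peq]
  refine integral_congr_ae (ae_of_all _ fun x => ?_)
  by_cases hx : x ∈ s <;> simp [hx]
end conv

lemma PS.of_IP {P : Measure ℝ} {f : ℝ → ℝ} {μ δ β γ : ℝ} (hδ : δ ≤ 0)
    (hIP : IsIntegratedPearson P f μ δ β γ)
    {α ω : EReal} (hsupp : {x : ℝ | 0 < f x} = erealIoo α ω) :
    PS P f μ δ β γ (erealIoo α ω) := by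
  obtain ⟨hP, fnn, Peq, idint, hμ, hne, hF⟩ := hIP
  have fm := aemeasurable_density hne hF
  have hi : Integrable (fun x => (x - μ)) P := idint.sub (integrable_const μ)
  have hi2 := (conv_integrable fm fnn Peq _).1 hi
  have hmean : ∫ x, (x - μ) ∂P = 0 := by
    rw [integral_sub idint (integrable_const μ)]; simp [hμ]
  refine ⟨hP, fnn, fun x hx => ?_, fun x hx => ?_, fm, Peq, hδ, isOpen_erealIoo _ _,
    ordConnected_erealIoo _ _, idint, hmean, fun t => ?_⟩
  · rw [← hsupp] at hx; exact hx
  · rw [← hsupp] at hx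
    exact le_antisymm (not_lt.1 hx) (fnn x)
  · rw [conv_setint fm fnn Peq _ measurableSet_Ioi, ← hF]
    rw [conv_int fm fnn Peq] at hmean
    have e := integral_add_compl (measurableSet_Ioi (a := t)) hi2
    rw [hmean, Set.compl_Ioi] at e
    have : ∫ x in Set.Iic t, (μ - x) * f x = - ∫ x in Set.Iic t, (x - μ) * f x := by
      rw [← integral_neg]; congr 1; ext x; ring
    rw [this]; linarith

namespace PS
variable {P : Measure ℝ} {f : ℝ → ℝ} {μ δ β γ : ℝ} {J : Set ℝ}

lemma int_eq (S : PS P f μ δ β γ J) (φ : ℝ → ℝ) : ∫ x, φ x ∂P = ∫ x, φ x * f x :=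
  conv_int S.fm S.fnn S.Peq φ

lemma acv (S : PS P f μ δ β γ J) : P ≪ volume := by
  rw [S.Peq]; exact withDensity_absolutelyContinuous _ _

lemma aeJ (S : PS P f μ δ β γ J) : ∀ᵐ x ∂P, x ∈ J := by
  rw [ae_iff]
  change P Jᶜ = 0
  rw [S.Peq, withDensity_apply _ S.Jo.measurableSet.compl]
  refine setLIntegral_eq_zero S.Jo.measurableSet.compl fun x hx => ?_
  simp [S.fzero x hx]

lemma setint_eq (S : PS P f μ δ β γ J) (φ : ℝ → ℝ) {s : Set ℝ} (hs : MeasurableSet s) :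
    ∫ x in s, φ x ∂P = ∫ x in J ∩ s, φ x * f x := by
  have : ∫ x in s, φ x ∂P = ∫ x in J ∩ s, φ x ∂P := by
    refine setIntegral_congr_set ?_
    filter_upwards [S.aeJ] with x hx
    exact propext ⟨fun h => ⟨hx, h⟩, fun h => h.2⟩
  rw [this]
  exact conv_setint S.fm S.fnn S.Peq φ (S.Jo.measurableSet.inter hs)

lemma intJ_eq (S : PS P f μ δ β γ J) (φ : ℝ → ℝ) : ∫ x, φ x ∂P = ∫ x in J, φ x * f x := by
  have := S.setint_eq φ MeasurableSet.univ
  simpa using this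

lemma intble (S : PS P f μ δ β γ J) {φ : ℝ → ℝ} (h : Integrable φ P) :
    Integrable (fun x => φ x * f x) := (conv_integrable S.fm S.fnn S.Peq φ).1 h

lemma intble' (S : PS P f μ δ β γ J) {φ : ℝ → ℝ} :
    Integrable φ P ↔ Integrable (fun x => φ x * f x) := (conv_integrable S.fm S.fnn S.Peq φ)

lemma measIoo (S : PS P f μ δ β γ J) {a b : ℝ} (hab : a < b) (h : Set.Ioo a b ⊆ J) :
    P (Set.Ioo a b) ≠ 0 := by
  rw [S.Peq]
  intro h0
  rw [withDensity_apply_eq_zero' S.fm.ennreal_ofReal] at h0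
  have : {x | ENNReal.ofReal (f x) ≠ 0} ∩ Set.Ioo a b = Set.Ioo a b := by
    ext x
    simp only [Set.mem_inter_iff, Set.mem_ofPred_eq, and_iff_right_iff_imp]
    intro hx
    simp [S.fpos x (h hx)]
  rw [this] at h0
  simp at h0
  linarith

/-- The zero of the linear factor lies in the support. -/
lemma mem_J (S : PS P f μ δ β γ J) {W : ℝ → ℝ} (hW : ∀ x ∈ J, 0 < W x) {ν : ℝ}
    (hi : Integrable (fun x => (x - ν) * W x) P) (h0 : ∫ x, (x - ν) * W x ∂P = 0) : ν ∈ J := by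
  by_contra hν
  have hP := S.prob
  have hne : (ae P).NeBot := inferInstance
  by_cases h : ∃ y ∈ J, y < ν
  · obtain ⟨y, hy, hyν⟩ := h
    have hlt : ∀ x ∈ J, x < ν := fun x hx => by
      by_contra hx'
      exact hν (S.Jc.out hy hx ⟨hyν.le, not_lt.1 hx'⟩)
    have h1 : ∫ x, -((x - ν) * W x) ∂P = 0 := by rw [integral_neg, h0, neg_zero]
    have hin : Integrable (fun x => -((x - ν) * W x)) P := hi.neg
    rw [integral_eq_zero_iff_of_nonneg_ae ?_ hin] at h1
    · have : ∀ᵐ x ∂P, False := by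
        filter_upwards [h1, S.aeJ] with x hx hxJ
        have := mul_neg_of_neg_of_pos (sub_neg.2 (hlt x hxJ)) (hW x hxJ)
        simp at hx
        rcases hx with hx | hx <;> nlinarith [hlt x hxJ, hW x hxJ]
      exact this.exists.elim fun _ h => h
    · filter_upwards [S.aeJ] with x hx
      have := mul_neg_of_neg_of_pos (sub_neg.2 (hlt x hx)) (hW x hx)
      simp only [Pi.zero_apply]; linarith
  · push Not at h
    have hlt : ∀ x ∈ J, ν < x := fun x hx => lt_of_le_of_ne (h x hx) (fun e => hν (e ▸ hx))
    rw [integral_eq_zero_iff_of_nonneg_ae ?_ hi] at h0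
    · have : ∀ᵐ x ∂P, False := by
        filter_upwards [h0, S.aeJ] with x hx hxJ
        have := mul_pos (sub_pos.2 (hlt x hxJ)) (hW x hxJ)
        simp at hx
        rcases hx with hx | hx <;> nlinarith [hlt x hxJ, hW x hxJ]
      exact this.exists.elim fun _ h => h
    · filter_upwards [S.aeJ] with x hx
      exact (mul_pos (sub_pos.2 (hlt x hx)) (hW x hx)).le

lemma hi (S : PS P f μ δ β γ J) : Integrable (fun x => x - μ) P := by
  have := S.prob
  exact S.idint.sub (integrable_const μ)

lemma μJ (S : PS P f μ δ β γ J) : μ ∈ J :=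
  S.mem_J (W := fun _ => 1) (by simp) (by simpa using S.hi) (by simpa using S.mean)

lemma tail' (S : PS P f μ δ β γ J) (t : ℝ) :
    -∫ x in Set.Iio t, (x - μ) ∂P = pq δ β γ t * f t := by
  have e := integral_add_compl (measurableSet_Ioi (a := t)) S.hi
  rw [S.mean, S.tail t, Set.compl_Ioi] at e
  have : ∫ x in Set.Iic t, (x - μ) ∂P = ∫ x in Set.Iio t, (x - μ) ∂P :=
    setIntegral_congr_set (S.acv.ae_eq Iio_ae_eq_Iic.symm)
  linarith

lemma qpos (S : PS P f μ δ β γ J) {t : ℝ} (ht : t ∈ J) : 0 < pq δ β γ t := by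
  have hf := S.fpos t ht
  suffices h : 0 < pq δ β γ t * f t from pos_of_mul_pos_left h hf.le
  obtain ⟨l, u, hlu, hsub⟩ := mem_nhds_iff_exists_Ioo_subset.1 (S.Jo.mem_nhds ht)
  rcases le_total μ t with h | h
  · have h1 : 0 ≤ ∫ x in Set.Ioi t, (x - μ) ∂P :=
      setIntegral_nonneg measurableSet_Ioi fun x hx => by
        have : t < x := hx
        linarith
    rw [← S.tail t]
    refine lt_of_le_of_ne h1 fun h0 => ?_
    have h0 := h0.symm
    rw [setIntegral_eq_zero_iff_of_nonneg_ae ?_ S.hi.integrableOn] at h0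
    · have h2 : ∀ᵐ x ∂(P.restrict (Set.Ioi t)), False := by
        filter_upwards [h0, ae_restrict_mem measurableSet_Ioi] with x hx hxt
        have : t < x := hxt
        simp at hx; linarith
      simp only [eventually_false_iff_eq_bot, ae_eq_bot, Measure.restrict_eq_zero] at h2
      refine S.measIoo hlu.2 (fun x hx => hsub ⟨hlu.1.trans hx.1, hx.2⟩) ?_
      exact measure_mono_null (fun x hx => hx.1) h2
    · filter_upwards [ae_restrict_mem measurableSet_Ioi] with x hxt
      have : t < x := hxt
      simp; linarith
  · have h1 : 0 ≤ ∫ x in Set.Iio t, -(x - μ) ∂P :=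
      setIntegral_nonneg measurableSet_Iio fun x hx => by
        have : x < t := hx
        linarith
    rw [← S.tail' t, ← integral_neg]
    refine lt_of_le_of_ne h1 fun h0 => ?_
    have h0 := h0.symm
    have hin : Integrable (fun x => -(x - μ)) P := S.hi.neg
    rw [setIntegral_eq_zero_iff_of_nonneg_ae ?_ hin.integrableOn] at h0
    · have h2 : ∀ᵐ x ∂(P.restrict (Set.Iio t)), False := by
        filter_upwards [h0, ae_restrict_mem measurableSet_Iio] with x hx hxt
        have : x < t := hxt
        simp at hx; linarith
      simp only [eventually_false_iff_eq_bot, ae_eq_bot, Measure.restrict_eq_zero] at h2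
      refine S.measIoo hlu.1 (fun x hx => hsub ⟨hx.1, hx.2.trans hlu.2⟩) ?_
      exact measure_mono_null (fun x hx => hx.2) h2
    · filter_upwards [ae_restrict_mem measurableSet_Iio] with x hxt
      have : x < t := hxt
      simp; linarith

end PS
end B1

section B2
namespace PS
variable {P : Measure ℝ} {f : ℝ → ℝ} {μ δ β γ : ℝ} {J : Set ℝ}

lemma pq_cont : Continuous (pq δ β γ) := by unfold pq; fun_prop

/-- measurability of continuous functions on `J` w.r.t. `P`. -/
lemma aesm (S : PS P f μ δ β γ J) {k : ℝ → ℝ} (hk : ContinuousOn k J) :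
    AEStronglyMeasurable k P := by
  have h := hk.aestronglyMeasurable (μ := P) S.Jo.measurableSet
  rwa [Measure.restrict_eq_self_of_ae_mem S.aeJ] at h

lemma aesm' (S : PS P f μ δ β γ J) {h h' : ℝ → ℝ} (H : FTC J h h') :
    AEStronglyMeasurable h' P := by
  have h1 := (H.aesm S.Jo).mono_ac (S.acv.restrict J)
  rwa [Measure.restrict_eq_self_of_ae_mem S.aeJ] at h1

lemma ibp (S : PS P f μ δ β γ J) {h h' : ℝ → ℝ} (H : FTC J h h')
    (hi : Integrable (fun x => pq δ β γ x * h' x) P) :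
    Integrable (fun x => (x - μ) * h x) P ∧
      ∫ x, (x - μ) * h x ∂P = ∫ x, pq δ β γ x * h' x ∂P := by
  have := S.prob
  have hI0 : IntegrableOn (fun t => (pq δ β γ t * f t) * h' t) J := by
    have := (S.intble hi).integrableOn (s := J)
    refine this.congr (ae_of_all _ fun x => ?_)
    simp only; ring
  obtain ⟨h1, h2⟩ := fub_full S.Jc S.Jo S.aeJ S.acv (V := fun x => x - μ)
    (U := fun t => pq δ β γ t * f t) S.μJ S.hi (fun x _ h => by linarith)
    (fun x _ h => by linarith) S.mean (fun t _ => S.tail t) H hI0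
  have h3 : (fun x => (x - μ) * h x) = fun x => (x - μ) * (h x - h μ) + h μ * (x - μ) := by
    ext x; ring
  rw [h3]
  refine ⟨h1.add (S.hi.const_mul _), ?_⟩
  rw [integral_add h1 (S.hi.const_mul _), integral_const_mul, S.mean, h2, S.intJ_eq]
  simp only [mul_zero, add_zero]
  congr 1; ext x; ring

lemma q_le (S : PS P f μ δ β γ J) (x : ℝ) : pq δ β γ x ≤ |β| * |x| + |γ| := by
  unfold pq
  have := S.hδ
  have h1 : δ * x ^ 2 ≤ 0 := mul_nonpos_of_nonpos_of_nonneg this (sq_nonneg x)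
  have h2 : β * x ≤ |β| * |x| := by rw [← abs_mul]; exact le_abs_self _
  linarith [le_abs_self γ]

lemma ftc_poly (hJ : J.OrdConnected) (p : Polynomial ℝ) :
    FTC J (fun x => p.eval x) (fun x => p.derivative.eval x) :=
  FTC.of_hasDerivAt hJ (fun x _ => p.hasDerivAt x) p.derivative.continuous.continuousOn

lemma moments (S : PS P f μ δ β γ J) (r : ℕ) : ∀ s ≤ r, Integrable (fun x : ℝ => x ^ s) P := by
  have := S.prob
  induction r with
  | zero => intro s hs; obtain rfl : s = 0 := by omega
            simp
  | succ r ih =>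
    intro s hs
    rcases hs.lt_or_eq with h | rfl
    · exact ih s (by omega)
    rcases Nat.eq_zero_or_pos r with rfl | hr
    · simpa using S.idint
    have H : FTC J (fun x : ℝ => x ^ r) (fun x : ℝ => r * x ^ (r - 1)) :=
      FTC.of_hasDerivAt S.Jc (fun x _ => hasDerivAt_pow r x) (by fun_prop)
    have hi : Integrable (fun x : ℝ => pq δ β γ x * (r * x ^ (r - 1))) P := by
      have hb : Integrable (fun x : ℝ => r * |β| * |x ^ r| + r * |γ| * |x ^ (r - 1)|) P :=
        ((ih r le_rfl).abs.const_mul _).add ((ih (r - 1) (by omega)).abs.const_mul _)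
      refine hb.mono' (S.aesm ?_) ?_
      · have := pq_cont (δ := δ) (β := β) (γ := γ); fun_prop
      · filter_upwards [S.aeJ] with x hx
        rw [Real.norm_eq_abs, abs_mul, abs_of_pos (S.qpos hx), abs_mul, Nat.abs_cast]
        calc _ ≤ (|β| * |x| + |γ|) * (r * |x ^ (r - 1)|) := by
              gcongr; exact S.q_le x
          _ = _ := by
            obtain ⟨k, rfl⟩ : ∃ k, r = k + 1 := ⟨r - 1, by omega⟩
            simp only [Nat.add_sub_cancel, pow_succ, abs_mul, abs_pow]; ring
    have h1 := (S.ibp H hi).1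
    have h2 := h1.add ((ih r le_rfl).const_mul μ)
    refine h2.congr (ae_of_all _ fun x => ?_)
    simp only [Pi.add_apply]; ring

lemma poly (S : PS P f μ δ β γ J) (p : Polynomial ℝ) : Integrable (fun x => p.eval x) P := by
  simp only [Polynomial.eval_eq_sum_range]
  exact integrable_finsetSum _ fun i _ => (S.moments i i le_rfl).const_mul _

end PS

/-- The quadratic as a polynomial. -/
def Qp (δ β γ : ℝ) : Polynomial ℝ := Polynomial.C δ * Polynomial.X ^ 2 +
  Polynomial.C β * Polynomial.X + Polynomial.C γ

lemma Qp_eval (δ β γ x : ℝ) : (Qp δ β γ).eval x = pq δ β γ x := by simp [Qp, pq]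

lemma Qp_der (δ β γ x : ℝ) : (Qp δ β γ).derivative.eval x = 2 * δ * x + β := by
  simp [Qp]; ring

namespace PS
variable {P : Measure ℝ} {f : ℝ → ℝ} {μ δ β γ : ℝ} {J : Set ℝ}

lemma qpow_int (S : PS P f μ δ β γ J) (i : ℕ) : Integrable (fun x => pq δ β γ x ^ i) P := by
  refine (S.poly (Qp δ β γ ^ i)).congr (ae_of_all _ fun x => ?_)
  simp [Qp_eval]

lemma qpow_poly (S : PS P f μ δ β γ J) (i : ℕ) (p : Polynomial ℝ) :
    Integrable (fun x => pq δ β γ x ^ i * p.eval x) P := by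
  refine (S.poly (Qp δ β γ ^ i * p)).congr (ae_of_all _ fun x => ?_)
  simp [Qp_eval]

lemma Epos (S : PS P f μ δ β γ J) (i : ℕ) : 0 < ∫ x, pq δ β γ x ^ i ∂P := by
  have := S.prob
  have hnn : 0 ≤ᵐ[P] fun x => pq δ β γ x ^ i := by
    filter_upwards [S.aeJ] with x hx
    exact (pow_pos (S.qpos hx) i).le
  refine lt_of_le_of_ne (integral_nonneg_of_ae hnn) fun h0 => ?_
  have h1 := (integral_eq_zero_iff_of_nonneg_ae hnn (S.qpow_int i)).1 h0.symm
  have : ∀ᵐ x ∂P, False := by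
    filter_upwards [h1, S.aeJ] with x hx hxJ
    exact (pow_pos (S.qpos hxJ) i).ne' hx
  exact this.exists.elim fun _ h => h

/-- linear factor times weight at level `i` -/
def Vl (μ δ β γ : ℝ) (i : ℕ) (x : ℝ) : ℝ := (x - μ - i * (2 * δ * x + β)) * pq δ β γ x ^ i

lemma Vl_int (S : PS P f μ δ β γ J) (i : ℕ) : Integrable (Vl μ δ β γ i) P := by
  refine (S.poly ((Polynomial.X - Polynomial.C μ - Polynomial.C (i : ℝ) *
    (Qp δ β γ).derivative) * Qp δ β γ ^ i)).congr (ae_of_all _ fun x => ?_)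
  simp [Vl, Qp_eval, Qp_der]

lemma ftc_qpow (S : PS P f μ δ β γ J) (i : ℕ) : FTC J (fun x => pq δ β γ x ^ i)
    (fun x => i * pq δ β γ x ^ (i - 1) * (2 * δ * x + β)) := by
  have := ftc_poly S.Jc (Qp δ β γ ^ i)
  simpa [Qp_eval, Polynomial.derivative_pow, Qp_der] using this

lemma qq (i : ℕ) (x : ℝ) : pq δ β γ x * (i * pq δ β γ x ^ (i - 1) * (2 * δ * x + β)) =
    i * (2 * δ * x + β) * pq δ β γ x ^ i := by
  cases i with
  | zero => simp
  | succ i => simp [pow_succ]; ring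

lemma lin_int (S : PS P f μ δ β γ J) (i : ℕ) :
    Integrable (fun x => i * (2 * δ * x + β) * pq δ β γ x ^ i) P := by
  refine (S.qpow_poly i (Polynomial.C (i : ℝ) * (Qp δ β γ).derivative)).congr
    (ae_of_all _ fun x => ?_)
  simp [Qp_der]; ring

lemma xm_int (S : PS P f μ δ β γ J) (i : ℕ) :
    Integrable (fun x => (x - μ) * pq δ β γ x ^ i) P := by
  refine (S.qpow_poly i (Polynomial.X - Polynomial.C μ)).congr
    (ae_of_all _ fun x => ?_)
  simp; ring

lemma Vl_right (S : PS P f μ δ β γ J) (i : ℕ) {t : ℝ} (ht : t ∈ J) (hμ : μ ≤ t) :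
    ∫ x in Set.Ioi t, Vl μ δ β γ i x ∂P = pq δ β γ t ^ (i + 1) * f t := by
  have := S.prob
  have hI0 : Integrable (fun s => pq δ β γ s * f s *
      (i * pq δ β γ s ^ (i - 1) * (2 * δ * s + β))) := by
    refine (S.intble (S.lin_int i)).congr (ae_of_all _ fun x => ?_)
    simp only; rw [← qq]; ring
  obtain ⟨-, h2⟩ := fub_right S.Jc S.Jo S.aeJ ht S.hi (V := fun x => x - μ)
    (U := fun t => pq δ β γ t * f t) (fun x _ h => by linarith) (fun s _ _ => S.tail s)
    (S.ftc_qpow i) hI0.integrableOn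
  have e1 : ∫ s in J ∩ Set.Ioi t, pq δ β γ s * f s *
      (i * pq δ β γ s ^ (i - 1) * (2 * δ * s + β)) =
      ∫ x in Set.Ioi t, i * (2 * δ * x + β) * pq δ β γ x ^ i ∂P := by
    rw [S.setint_eq _ measurableSet_Ioi]
    congr 1; ext x; rw [← qq]; ring
  rw [e1] at h2
  have e2 : ∀ x, (x - μ) * (pq δ β γ x ^ i - pq δ β γ t ^ i) =
      (x - μ) * pq δ β γ x ^ i - pq δ β γ t ^ i * (x - μ) := fun x => by ring
  simp only [e2] at h2
  rw [integral_sub (S.xm_int i).integrableOn (S.hi.const_mul _).integrableOn, integral_const_mul,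
    S.tail] at h2
  have e3 : ∀ x, Vl μ δ β γ i x = (x - μ) * pq δ β γ x ^ i -
    i * (2 * δ * x + β) * pq δ β γ x ^ i := fun x => by unfold Vl; ring
  simp only [e3]
  rw [integral_sub (S.xm_int i).integrableOn (S.lin_int i).integrableOn]
  rw [pow_succ]; linarith

lemma Vl_left (S : PS P f μ δ β γ J) (i : ℕ) {t : ℝ} (ht : t ∈ J) (hμ : t ≤ μ) :
    -∫ x in Set.Iio t, Vl μ δ β γ i x ∂P = pq δ β γ t ^ (i + 1) * f t := by
  have := S.prob
  have hI0 : Integrable (fun s => pq δ β γ s * f s *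
      (i * pq δ β γ s ^ (i - 1) * (2 * δ * s + β))) := by
    refine (S.intble (S.lin_int i)).congr (ae_of_all _ fun x => ?_)
    simp only; rw [← qq]; ring
  obtain ⟨-, h2⟩ := fub_left S.Jc S.Jo S.aeJ ht S.hi (V := fun x => x - μ)
    (U := fun t => pq δ β γ t * f t) (fun x _ h => by linarith) (fun s _ _ => S.tail' s)
    (S.ftc_qpow i) hI0.integrableOn
  have e1 : ∫ s in J ∩ Set.Iio t, pq δ β γ s * f s *
      (i * pq δ β γ s ^ (i - 1) * (2 * δ * s + β)) =
      ∫ x in Set.Iio t, i * (2 * δ * x + β) * pq δ β γ x ^ i ∂P := by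
    rw [S.setint_eq _ measurableSet_Iio]
    congr 1; ext x; rw [← qq]; ring
  rw [e1] at h2
  have e2 : ∀ x, (x - μ) * (pq δ β γ x ^ i - pq δ β γ t ^ i) =
      (x - μ) * pq δ β γ x ^ i - pq δ β γ t ^ i * (x - μ) := fun x => by ring
  simp only [e2] at h2
  have h3 := S.tail' t
  rw [integral_sub (S.xm_int i).integrableOn (S.hi.const_mul _).integrableOn, integral_const_mul] at h2
  have e3 : ∀ x, Vl μ δ β γ i x = (x - μ) * pq δ β γ x ^ i -
    i * (2 * δ * x + β) * pq δ β γ x ^ i := fun x => by unfold Vl; ring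
  simp only [e3]
  rw [integral_sub (S.xm_int i).integrableOn (S.lin_int i).integrableOn]
  have h4 : pq δ β γ t ^ (i + 1) * f t = pq δ β γ t ^ i * (pq δ β γ t * f t) := by ring
  rw [h4, ← h3]; linarith

lemma Iio_Iic (S : PS P f μ δ β γ J) (φ : ℝ → ℝ) (t : ℝ) :
    ∫ x in Set.Iic t, φ x ∂P = ∫ x in Set.Iio t, φ x ∂P :=
  setIntegral_congr_set (S.acv.ae_eq Iio_ae_eq_Iic.symm)

lemma Vl_mean (S : PS P f μ δ β γ J) (i : ℕ) : ∫ x, Vl μ δ β γ i x ∂P = 0 := by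
  have e := integral_add_compl (measurableSet_Ioi (a := μ)) (S.Vl_int i)
  rw [Set.compl_Ioi, S.Iio_Iic, S.Vl_right i S.μJ le_rfl] at e
  linarith [S.Vl_left i S.μJ le_rfl]

lemma Vl_tail (S : PS P f μ δ β γ J) (i : ℕ) {t : ℝ} (ht : t ∈ J) :
    ∫ x in Set.Ioi t, Vl μ δ β γ i x ∂P = pq δ β γ t ^ (i + 1) * f t := by
  rcases le_total μ t with h | h
  · exact S.Vl_right i ht h
  have e := integral_add_compl (measurableSet_Ioi (a := t)) (S.Vl_int i)
  rw [Set.compl_Ioi, S.Iio_Iic, S.Vl_mean] at e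
  linarith [S.Vl_left i ht h]

end PS
end B2

section B3
/-- tilted density -/
def ftilt (P : Measure ℝ) (f : ℝ → ℝ) (δ β γ : ℝ) (i : ℕ) (x : ℝ) : ℝ :=
  pq δ β γ x ^ i * f x / ∫ y, pq δ β γ y ^ i ∂P

/-- tilted measure -/
def Ptilt (P : Measure ℝ) (f : ℝ → ℝ) (δ β γ : ℝ) (i : ℕ) : Measure ℝ :=
  volume.withDensity (fun x => ENNReal.ofReal (ftilt P f δ β γ i x))

namespace PS
variable {P : Measure ℝ} {f : ℝ → ℝ} {μ δ β γ : ℝ} {J : Set ℝ}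

lemma ftilt_nn (S : PS P f μ δ β γ J) (i : ℕ) (x : ℝ) : 0 ≤ ftilt P f δ β γ i x := by
  unfold ftilt
  by_cases hx : x ∈ J
  · exact div_nonneg (mul_nonneg (pow_pos (S.qpos hx) i).le (S.fnn x)) (S.Epos i).le
  · simp [S.fzero x hx]

lemma ftilt_m (S : PS P f μ δ β γ J) (i : ℕ) : AEMeasurable (ftilt P f δ β γ i) := by
  unfold ftilt
  have := pq_cont (δ := δ) (β := β) (γ := γ)
  exact ((this.measurable.pow_const i).aemeasurable.mul S.fm).div_const _

lemma Ptilt_eq (_ : PS P f μ δ β γ J) (i : ℕ) : Ptilt P f δ β γ i =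
    volume.withDensity (fun x => ENNReal.ofReal (ftilt P f δ β γ i x)) := rfl

lemma tilt_int (S : PS P f μ δ β γ J) (i : ℕ) (φ : ℝ → ℝ) :
    ∫ x, φ x ∂(Ptilt P f δ β γ i) = (∫ x, pq δ β γ x ^ i * φ x ∂P) / ∫ y, pq δ β γ y ^ i ∂P := by
  rw [conv_int (S.ftilt_m i) (S.ftilt_nn i) (S.Ptilt_eq i), S.int_eq (fun x => pq δ β γ x ^ i * φ x),
    ← integral_div]
  congr 1; ext x; unfold ftilt; ring

lemma tilt_setint (S : PS P f μ δ β γ J) (i : ℕ) (φ : ℝ → ℝ) {s : Set ℝ} (hs : MeasurableSet s) :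
    ∫ x in s, φ x ∂(Ptilt P f δ β γ i) =
      (∫ x in s, pq δ β γ x ^ i * φ x ∂P) / ∫ y, pq δ β γ y ^ i ∂P := by
  rw [conv_setint (S.ftilt_m i) (S.ftilt_nn i) (S.Ptilt_eq i) φ hs,
    conv_setint S.fm S.fnn S.Peq (fun x => pq δ β γ x ^ i * φ x) hs,
    ← integral_div]
  congr 1; ext x; unfold ftilt; ring

lemma tilt_integrable (S : PS P f μ δ β γ J) (i : ℕ) (φ : ℝ → ℝ) :
    Integrable φ (Ptilt P f δ β γ i) ↔ Integrable (fun x => pq δ β γ x ^ i * φ x) P := by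
  rw [conv_integrable (S.ftilt_m i) (S.ftilt_nn i) (S.Ptilt_eq i), S.intble']
  have hE := (S.Epos i).ne'
  constructor
  · intro h
    refine (h.mul_const (∫ y, pq δ β γ y ^ i ∂P)).congr (ae_of_all _ fun x => ?_)
    simp only [ftilt]; field_simp
  · intro h
    refine (h.div_const (∫ y, pq δ β γ y ^ i ∂P)).congr (ae_of_all _ fun x => ?_)
    simp only [ftilt]; ring

lemma s_pos (S : PS P f μ δ β γ J) (i : ℕ) : 0 < 1 - 2 * i * δ := by
  have := S.hδ
  have h : (0:ℝ) ≤ i := Nat.cast_nonneg i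
  nlinarith

lemma Vl_eq (S : PS P f μ δ β γ J) (i : ℕ) (x : ℝ) : Vl μ δ β γ i x =
    (1 - 2 * i * δ) * (pq δ β γ x ^ i * (x - (μ + i * β) / (1 - 2 * i * δ))) := by
  have := (S.s_pos i).ne'
  have h2 : (1 - 2 * i * δ) * ((μ + i * β) / (1 - 2 * i * δ)) = μ + i * β := mul_div_cancel₀ _ this
  unfold Vl
  linear_combination (pq δ β γ x ^ i) * h2

lemma pq_scale (s x : ℝ) : pq (δ / s) (β / s) (γ / s) x = pq δ β γ x / s := by
  unfold pq; ring

lemma tilt (S : PS P f μ δ β γ J) (i : ℕ) : PS (Ptilt P f δ β γ i) (ftilt P f δ β γ i)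
    ((μ + i * β) / (1 - 2 * i * δ)) (δ / (1 - 2 * i * δ)) (β / (1 - 2 * i * δ))
    (γ / (1 - 2 * i * δ)) J := by
  have hs := S.s_pos i
  have hE := S.Epos i
  have hmean : ∫ x, (x - (μ + i * β) / (1 - 2 * i * δ)) ∂(Ptilt P f δ β γ i) = 0 := by
    rw [S.tilt_int]
    have := S.Vl_mean i
    simp only [S.Vl_eq] at this
    rw [integral_const_mul] at this
    rw [(mul_eq_zero.1 this).resolve_left hs.ne']; simp
  refine ⟨⟨?_⟩, S.ftilt_nn i, fun x hx => ?_, fun x hx => ?_, S.ftilt_m i, rfl, ?_, S.Jo, S.Jc,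
    ?_, hmean, fun t => ?_⟩
  · have h1 : Integrable (fun _ : ℝ => (1:ℝ)) (Ptilt P f δ β γ i) := by
      rw [S.tilt_integrable]; simpa using S.qpow_int i
    have h2 := S.tilt_int i (fun _ => 1)
    simp only [mul_one, div_self hE.ne'] at h2
    rw [integrable_const_iff] at h1
    have h3 : IsFiniteMeasure (Ptilt P f δ β γ i) := by simpa using h1
    simp only [integral_const, smul_eq_mul, mul_one, measureReal_def] at h2
    rw [← ENNReal.toReal_one, ENNReal.toReal_eq_toReal_iff' (by simp) (by simp)] at h2
    exact h2
  · exact div_pos (mul_pos (pow_pos (S.qpos hx) i) (S.fpos x hx)) hE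
  · simp [ftilt, S.fzero x hx]
  · exact div_nonpos_of_nonpos_of_nonneg S.hδ hs.le
  · rw [S.tilt_integrable]
    simpa using S.qpow_poly i Polynomial.X
  · rw [S.tilt_setint i _ measurableSet_Ioi, pq_scale]
    by_cases ht : t ∈ J
    · have := S.Vl_tail i ht
      simp only [S.Vl_eq] at this
      rw [integral_const_mul] at this
      rw [ftilt]
      generalize (∫ x in Set.Ioi t, pq δ β γ x ^ i *
        (x - (μ + i * β) / (1 - 2 * i * δ)) ∂P) = I at this ⊢
      generalize 1 - 2 * i * δ = s at this hs ⊢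
      have hs' := hs.ne'
      rw [div_mul_div_comm, div_eq_div_iff (by positivity) (by positivity)]
      linear_combination (∫ y, pq δ β γ y ^ i ∂P) * this
    · have : ∫ x in Set.Ioi t, Vl μ δ β γ i x ∂P = 0 := by
        by_cases h : μ < t
        · refine setIntegral_eq_zero_of_ae_eq_zero ?_
          filter_upwards [S.aeJ] with x hx hxt
          exact absurd (S.Jc.out S.μJ hx ⟨h.le, le_of_lt hxt⟩) ht
        · have e := integral_add_compl (measurableSet_Ioi (a := t)) (S.Vl_int i)
          rw [S.Vl_mean] at e
          have : ∫ x in (Set.Ioi t)ᶜ, Vl μ δ β γ i x ∂P = 0 := by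
            refine setIntegral_eq_zero_of_ae_eq_zero ?_
            filter_upwards [S.aeJ] with x hx hxt
            exact absurd (S.Jc.out hx S.μJ ⟨by simpa using hxt, not_lt.1 h⟩) ht
          linarith
      simp only [S.Vl_eq] at this
      rw [integral_const_mul] at this
      rw [(mul_eq_zero.1 this).resolve_left hs.ne']
      simp [ftilt, S.fzero t ht]

/-- Integration by parts at level `i`. -/
lemma ibpl (S : PS P f μ δ β γ J) (i : ℕ) {h h' : ℝ → ℝ} (H : FTC J h h')
    (hi : Integrable (fun x => pq δ β γ x ^ (i + 1) * h' x) P) :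
    Integrable (fun x => Vl μ δ β γ i x * h x) P ∧
      ∫ x, Vl μ δ β γ i x * h x ∂P = ∫ x, pq δ β γ x ^ (i + 1) * h' x ∂P := by
  have hs := S.s_pos i
  have hE := S.Epos i
  obtain ⟨h1, h2⟩ := (S.tilt i).ibp H (by
    rw [S.tilt_integrable]
    refine (hi.div_const (1 - 2 * i * δ)).congr (ae_of_all _ fun x => ?_)
    simp only [pq_scale]; ring)
  rw [S.tilt_integrable] at h1
  rw [S.tilt_int, S.tilt_int] at h2
  constructor
  · refine (h1.const_mul (1 - 2 * i * δ)).congr (ae_of_all _ fun x => ?_)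
    simp only [S.Vl_eq]; ring
  · have h3 := (div_left_inj' hE.ne').1 h2
    have e1 : ∀ x, Vl μ δ β γ i x * h x = (1 - 2 * i * δ) *
      (pq δ β γ x ^ i * ((x - (μ + i * β) / (1 - 2 * i * δ)) * h x)) := fun x => by
      rw [S.Vl_eq]; ring
    simp only [e1]
    rw [integral_const_mul, h3, ← integral_const_mul]
    congr 1; ext x; rw [pq_scale]; field_simp; ring

end PS
end B3

section B4
namespace PS
variable {P : Measure ℝ} {f : ℝ → ℝ} {μ δ β γ : ℝ} {J : Set ℝ}

lemma near (S : PS P f μ δ β γ J) {k : ℝ → ℝ} (hk : ContinuousOn k J)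
    (hi : Integrable (fun x => (x - μ) * k x) P) : Integrable k P := by
  have := S.prob
  obtain ⟨ε, hε, hsub⟩ := Metric.nhds_basis_closedBall.mem_iff.1 (S.Jo.mem_nhds S.μJ)
  obtain ⟨M, hM⟩ := (isCompact_closedBall μ ε).exists_bound_of_continuousOn (hk.mono hsub)
  have hM0 : 0 ≤ M := (norm_nonneg _).trans (hM μ (Metric.mem_closedBall_self hε.le))
  refine ((integrable_const M).add (hi.abs.div_const ε)).mono' (S.aesm hk) (ae_of_all _ fun x => ?_)
  simp only [Pi.add_apply]
  by_cases hx : x ∈ Metric.closedBall μ ε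
  · have := hM x hx
    have h2 : 0 ≤ |(x - μ) * k x| / ε := by positivity
    linarith
  · simp only [Metric.mem_closedBall, Real.dist_eq, not_le] at hx
    have : ‖k x‖ ≤ |(x - μ) * k x| / ε := by
      rw [le_div_iff₀ hε, abs_mul, Real.norm_eq_abs, mul_comm]
      gcongr
    linarith

lemma hardy1 (S : PS P f μ δ β γ J) {h h' : ℝ → ℝ} (H : FTC J h h')
    (hi : Integrable (fun x => pq δ β γ x * h' x) P) :
    Integrable h P ∧ Integrable (fun x => x * h x) P := by
  have h1 := (S.ibp H hi).1
  have h2 := S.near (FTC.continuousOn S.Jc S.Jo H) h1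
  refine ⟨h2, (h1.add (h2.const_mul μ)).congr (ae_of_all _ fun x => ?_)⟩
  simp only [Pi.add_apply]; ring

lemma hardyW (S : PS P f μ δ β γ J) {h h' : ℝ → ℝ} (H : FTC J h h') (r : ℕ)
    (hi : ∀ s ≤ r, Integrable (fun x => pq δ β γ x * (h' x * x ^ s)) P) :
    ∀ s ≤ r + 1, Integrable (fun x => h x * x ^ s) P := by
  induction r with
  | zero =>
    have := S.hardy1 H (by simpa using hi 0 le_rfl)
    intro s hs
    rcases Nat.le_one_iff_eq_zero_or_eq_one.1 hs with rfl | rfl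
    · simpa using this.1
    · simpa [mul_comm] using this.2
  | succ r ih =>
    have ih := ih fun s hs => hi s (by omega)
    intro s hs
    rcases hs.lt_or_eq with hs | rfl
    · exact ih s (by omega)
    have hc := FTC.continuousOn S.Jc S.Jo H
    have H2 : FTC J (fun x : ℝ => x ^ (r + 1)) (fun x : ℝ => ((r + 1 : ℕ) : ℝ) * x ^ r) :=
      FTC.of_hasDerivAt S.Jc (fun x _ => by simpa using hasDerivAt_pow (r + 1) x) (by fun_prop)
    have H3 := FTC.mul S.Jc H H2
    have hq := pq_cont (δ := δ) (β := β) (γ := γ)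
    have b : Integrable (fun x => pq δ β γ x * (h x * (((r + 1 : ℕ) : ℝ) * x ^ r))) P := by
      have hb : Integrable (fun x : ℝ => ((r + 1 : ℕ) : ℝ) * |β| * |h x * x ^ (r + 1)| +
          ((r + 1 : ℕ) : ℝ) * |γ| * |h x * x ^ r|) P :=
        ((ih (r + 1) le_rfl).abs.const_mul _).add ((ih r (by omega)).abs.const_mul _)
      refine hb.mono' (S.aesm (by fun_prop)) ?_
      filter_upwards [S.aeJ] with x hx
      rw [Real.norm_eq_abs, abs_mul, abs_of_pos (S.qpos hx), abs_mul, abs_mul, Nat.abs_cast]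
      calc _ ≤ (|β| * |x| + |γ|) * (|h x| * (((r + 1 : ℕ) : ℝ) * |x ^ r|)) := by
            gcongr; exact S.q_le x
        _ = _ := by simp only [pow_succ, abs_mul, abs_pow]; ring
    have h4 := S.hardy1 H3 (by
      refine ((hi (r + 1) le_rfl).add b).congr (ae_of_all _ fun x => ?_)
      simp only [Pi.add_apply]; ring)
    refine h4.2.congr (ae_of_all _ fun x => ?_)
    simp only; ring

/-- weighted Hardy at level `i` -/
lemma hardyWl (S : PS P f μ δ β γ J) (i : ℕ) {h h' : ℝ → ℝ} (H : FTC J h h') (r : ℕ)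
    (hi : ∀ s ≤ r, Integrable (fun x => pq δ β γ x ^ (i + 1) * (h' x * x ^ s)) P) :
    ∀ s ≤ r + 1, Integrable (fun x => pq δ β γ x ^ i * (h x * x ^ s)) P := by
  intro s hs
  have := (S.tilt i).hardyW H r (fun s hs => by
    rw [S.tilt_integrable]
    refine ((hi s hs).div_const (1 - 2 * i * δ)).congr (ae_of_all _ fun x => ?_)
    simp only [pq_scale]; ring) s hs
  rwa [S.tilt_integrable] at this

lemma F_lower (S : PS P f μ δ β γ J) {a b : ℝ} (ha : a ∈ J) (hb : b ∈ J) :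
    ∃ m > 0, ∀ t ∈ Set.Icc a b, m ≤ pq δ β γ t * f t := by
  refine ⟨min (pq δ β γ a * f a) (pq δ β γ b * f b),
    lt_min (mul_pos (S.qpos ha) (S.fpos a ha)) (mul_pos (S.qpos hb) (S.fpos b hb)),
    fun t ht => ?_⟩
  rcases le_total μ t with h | h
  · refine (min_le_right _ _).trans ?_
    rw [← S.tail, ← S.tail]
    refine setIntegral_mono_set S.hi.integrableOn ?_ (Set.Ioi_subset_Ioi ht.2).eventuallyLE
    filter_upwards [ae_restrict_mem measurableSet_Ioi] with x hx
    have : t < x := hx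
    simp only [Pi.zero_apply]; linarith
  · refine (min_le_left _ _).trans ?_
    rw [← S.tail', ← S.tail', ← integral_neg, ← integral_neg]
    refine setIntegral_mono_set S.hi.neg.integrableOn ?_ (Set.Iio_subset_Iio ht.1).eventuallyLE
    filter_upwards [ae_restrict_mem measurableSet_Iio] with x hx
    have : x < t := hx
    simp only [Pi.zero_apply]; linarith

lemma cs_interval {u v : ℝ} (huv : u < v) {k : ℝ → ℝ} (h1 : IntervalIntegrable k volume u v)
    (h2 : IntervalIntegrable (fun t => k t ^ 2) volume u v) :
    (∫ t in u..v, k t) ^ 2 ≤ (v - u) * ∫ t in u..v, k t ^ 2 := by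
  set A := ∫ t in u..v, k t
  set B := ∫ t in u..v, k t ^ 2
  have hL : 0 < v - u := sub_pos.2 huv
  have h3 : 0 ≤ ∫ t in u..v, (k t - A / (v - u)) ^ 2 :=
    intervalIntegral.integral_nonneg huv.le fun t _ => sq_nonneg _
  have e : ∀ t, (k t - A / (v - u)) ^ 2 = k t ^ 2 - 2 * (A / (v - u)) * k t + (A / (v - u)) ^ 2 :=
    fun t => by ring
  simp only [e] at h3
  rw [intervalIntegral.integral_add (h2.sub (h1.const_mul _)) (by simp),
    intervalIntegral.integral_sub h2 (h1.const_mul _), intervalIntegral.integral_const_mul,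
    intervalIntegral.integral_const, smul_eq_mul] at h3
  change 0 ≤ B - 2 * (A / (v - u)) * A + (v - u) * (A / (v - u)) ^ 2 at h3
  have : B - 2 * (A / (v - u)) * A + (v - u) * (A / (v - u)) ^ 2 = B - A ^ 2 / (v - u) := by
    field_simp; ring
  rw [this] at h3
  have : A ^ 2 / (v - u) ≤ B := by linarith
  rw [div_le_iff₀ hL] at this
  linarith

lemma hardy2 (S : PS P f μ δ β γ J) {h h' : ℝ → ℝ} (H : FTC J h h')
    (hi : Integrable (fun x => pq δ β γ x * h' x ^ 2) P) : Integrable (fun x => h x ^ 2) P := by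
  have := S.prob
  have hloc0 : ∀ a ∈ J, ∀ b ∈ J, a ≤ b → IntervalIntegrable (fun t => h' t ^ 2) volume a b := by
    intro a ha b hb hab
    rw [intervalIntegrable_iff_integrableOn_Icc_of_le hab]
    obtain ⟨m, hm, hF⟩ := S.F_lower ha hb
    have hsub : Set.Icc a b ⊆ J := S.Jc.out ha hb
    have h1 := (S.intble hi).integrableOn (s := Set.Icc a b)
    refine (h1.div_const m).mono' ?_ ?_
    · exact (((H.aesm S.Jo).mono_measure (Measure.restrict_mono hsub le_rfl)).pow 2)
    · filter_upwards [ae_restrict_mem measurableSet_Icc] with x hx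
      have := hF x hx
      rw [Real.norm_eq_abs, abs_of_nonneg (sq_nonneg _), le_div_iff₀ hm]
      nlinarith [sq_nonneg (h' x)]
  have hloc : ∀ a ∈ J, ∀ b ∈ J, IntervalIntegrable (fun t => h' t ^ 2) volume a b := by
    intro a ha b hb
    rcases le_total a b with hab | hab
    · exact hloc0 a ha b hb hab
    · exact (hloc0 b hb a ha hab).symm
  have HK : FTC J (fun x => ∫ t in μ..x, h' t ^ 2) (fun t => h' t ^ 2) := by
    intro a ha b hb
    refine ⟨hloc a ha b hb, ?_⟩
    exact intervalIntegral.integral_interval_sub_left (hloc _ S.μJ _ hb) (hloc _ S.μJ _ ha)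
  have h1 := (S.ibp HK hi).1
  have hb : Integrable (fun x => 2 * ((x - μ) * ∫ t in μ..x, h' t ^ 2) + 2 * h μ ^ 2) P :=
    (h1.const_mul 2).add (integrable_const _)
  refine hb.mono' ((S.aesm (FTC.continuousOn S.Jc S.Jo H)).pow 2) ?_
  filter_upwards [S.aeJ] with x hx
  have key : (h x - h μ) ^ 2 ≤ (x - μ) * ∫ t in μ..x, h' t ^ 2 := by
    rcases lt_trichotomy μ x with hl | hl | hl
    · rw [(H μ S.μJ x hx).2]
      exact cs_interval hl (H μ S.μJ x hx).1 (hloc _ S.μJ _ hx)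
    · subst hl; simp
    · have e := cs_interval hl (H x hx μ S.μJ).1 (hloc _ hx _ S.μJ)
      rw [← (H x hx μ S.μJ).2] at e
      rw [intervalIntegral.integral_symm]
      nlinarith
  rw [Real.norm_eq_abs, abs_of_nonneg (sq_nonneg _)]
  nlinarith [sq_nonneg (h x - 2 * h μ)]

lemma hardy2l (S : PS P f μ δ β γ J) (i : ℕ) {h h' : ℝ → ℝ} (H : FTC J h h')
    (hi : Integrable (fun x => pq δ β γ x ^ (i + 1) * h' x ^ 2) P) :
    Integrable (fun x => pq δ β γ x ^ i * h x ^ 2) P := by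
  have := (S.tilt i).hardy2 H (by
    rw [S.tilt_integrable]
    refine (hi.div_const (1 - 2 * i * δ)).congr (ae_of_all _ fun x => ?_)
    simp only [pq_scale]; ring)
  rwa [S.tilt_integrable] at this

/-- `q^i h²` integrable implies `q^i h p` integrable for polynomials -/
lemma l2poly (S : PS P f μ δ β γ J) (i : ℕ) {h : ℝ → ℝ} (hm : AEStronglyMeasurable h P)
    (hi : Integrable (fun x => pq δ β γ x ^ i * h x ^ 2) P) (p : Polynomial ℝ) :
    Integrable (fun x => pq δ β γ x ^ i * (h x * p.eval x)) P := by
  have hb := hi.add (S.qpow_poly i (p ^ 2))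
  have hq := pq_cont (δ := δ) (β := β) (γ := γ)
  refine hb.mono' ?_ ?_
  · exact (hq.pow i).aestronglyMeasurable.mul (hm.mul p.continuous.aestronglyMeasurable)
  · filter_upwards [S.aeJ] with x hx
    have := pow_pos (S.qpos hx) i
    simp only [Pi.add_apply, Polynomial.eval_pow]
    rw [Real.norm_eq_abs, abs_mul, abs_of_pos this, ← mul_add]
    gcongr
    rw [abs_mul]
    nlinarith [sq_abs (h x), sq_abs (p.eval x), sq_nonneg (|h x| - |p.eval x|), sq_nonneg (|h x|),
      sq_nonneg (|p.eval x|)]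

end PS
end B4

section C1
/-- eigenvalues -/
def lam (δ : ℝ) (k : ℕ) : ℝ := k * (1 - (k - 1) * δ)

lemma lam_succ (δ : ℝ) (k : ℕ) : lam δ (k + 1) = lam δ k + (1 - 2 * k * δ) := by
  unfold lam; push_cast; ring

lemma lam_zero (δ : ℝ) : lam δ 0 = 0 := by simp [lam]

lemma lam_strictMono {δ : ℝ} (hδ : δ ≤ 0) : StrictMono (lam δ) := by
  refine strictMono_nat_of_lt_succ fun k => ?_
  rw [lam_succ]
  have h : (0:ℝ) ≤ k := Nat.cast_nonneg k
  nlinarith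

/-- products of eigenvalue gaps -/
def Lam (δ : ℝ) (k i : ℕ) : ℝ := ∏ j ∈ range i, (lam δ k - lam δ j)

lemma Lam_succ (δ : ℝ) (k i : ℕ) : Lam δ k (i + 1) = Lam δ k i * (lam δ k - lam δ i) := by
  simp [Lam, prod_range_succ]

lemma Lam_zero (δ : ℝ) (k : ℕ) : Lam δ k 0 = 1 := by simp [Lam]

lemma Lam_eq_zero (δ : ℝ) {k i : ℕ} (h : k < i) : Lam δ k i = 0 :=
  prod_eq_zero (mem_range.2 h) (sub_self _)

lemma Lam_pos {δ : ℝ} (hδ : δ ≤ 0) {k i : ℕ} (h : i ≤ k) : 0 < Lam δ k i :=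
  prod_pos fun _ hj => sub_pos.2 (lam_strictMono hδ ((mem_range.1 hj).trans_le h))

open Polynomial in
/-- the Pearson differential operator -/
def Lop (μ δ β γ : ℝ) (p : ℝ[X]) : ℝ[X] :=
  Qp δ β γ * derivative (derivative p) + (C μ - X) * derivative p

section
open Polynomial
variable {μ δ β γ : ℝ}

lemma Lop_add (p r : ℝ[X]) : Lop μ δ β γ (p + r) = Lop μ δ β γ p + Lop μ δ β γ r := by
  simp only [Lop, derivative_add]; ring

lemma Lop_coeff (p : ℝ[X]) (i : ℕ) : (Lop μ δ β γ p).coeff i = - lam δ i * p.coeff i +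
    (β * i + μ) * (i + 1) * p.coeff (i + 1) + γ * (i + 2) * (i + 1) * p.coeff (i + 2) := by
  have e : Lop μ δ β γ p = C δ * (derivative (derivative p) * X ^ 2) +
    C β * (derivative (derivative p) * X) + C γ * derivative (derivative p) + C μ * derivative p -
      derivative p * X := by unfold Lop Qp; ring
  rw [e]
  simp only [coeff_add, coeff_sub, coeff_C_mul]
  rcases i with _ | _ | i
  · simp [coeff_derivative, lam]; ring
  · simp [coeff_derivative, lam, coeff_mul_X_pow']; ring
  · rw [coeff_mul_X_pow, coeff_mul_X, coeff_mul_X]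
    simp [coeff_derivative, lam]; ring

lemma solve_op (hδ : δ ≤ 0) (k : ℕ) : ∀ j ≤ k, ∀ p : ℝ[X], (∀ i, j ≤ i → p.coeff i = 0) →
    ∃ r : ℝ[X], (∀ i, j ≤ i → r.coeff i = 0) ∧ Lop μ δ β γ r + C (lam δ k) * r = p := by
  intro j
  induction j with
  | zero =>
    intro _ p hp
    have : p = 0 := by ext i; simpa using hp i (Nat.zero_le _)
    exact ⟨0, by simp, by simp [Lop, this]⟩
  | succ j ih =>
    intro hj p hp
    have hl : lam δ k - lam δ j ≠ 0 := (sub_pos.2 (lam_strictMono hδ hj)).ne'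
    set r1 : ℝ[X] := monomial j (p.coeff j / (lam δ k - lam δ j)) with hr1
    obtain ⟨r, hr, hr2⟩ := ih (by omega) (p - (Lop μ δ β γ r1 + C (lam δ k) * r1)) (by
      intro i hi
      rw [coeff_sub, coeff_add, coeff_C_mul, Lop_coeff]
      rcases hi.lt_or_eq with h | rfl
      · simp [hr1, coeff_monomial, h.ne, hp i h, show j ≠ i + 1 by omega, show j ≠ i + 2 by omega]
      · simp only [hr1, coeff_monomial]
        simp
        field_simp; ring)
    refine ⟨r1 + r, fun i hi => ?_, ?_⟩
    · rw [coeff_add, hr i (by omega)]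
      simp [hr1, coeff_monomial, show j ≠ i by omega]
    · rw [Lop_add]
      linear_combination hr2

lemma exists_eig (hδ : δ ≤ 0) (k : ℕ) : ∃ φ : ℝ[X], φ.Monic ∧ φ.natDegree = k ∧
    Lop μ δ β γ φ + C (lam δ k) * φ = 0 := by
  obtain ⟨r, hr, hr2⟩ := solve_op (μ := μ) (β := β) (γ := γ) hδ k k le_rfl
    (-(Lop μ δ β γ (X ^ k) + C (lam δ k) * X ^ k)) (by
      intro i hi
      rw [coeff_neg, coeff_add, coeff_C_mul, Lop_coeff]
      simp only [coeff_X_pow, show i + 1 ≠ k by omega, show i + 2 ≠ k by omega, if_false]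
      rcases hi.lt_or_eq with h | rfl
      · simp [show i ≠ k by omega]
      · simp)
  have hd : r.degree < (X ^ k : ℝ[X]).degree := by
    rw [degree_X_pow, degree_lt_iff_coeff_zero]; exact hr
  have hdeg : (X ^ k + r).natDegree = k := by
    rw [natDegree_eq_of_degree_eq (degree_add_eq_left_of_degree_lt hd)]; simp
  refine ⟨X ^ k + r, ?_, hdeg, ?_⟩
  · exact (monic_X_pow k).add_of_left hd
  · rw [Lop_add]; linear_combination hr2

/-- a family of eigenpolynomials -/
structure Eig (μ δ β γ : ℝ) (φ : ℕ → ℝ[X]) : Prop where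
  monic : ∀ k, (φ k).Monic
  deg : ∀ k, (φ k).natDegree = k
  eig : ∀ k, Lop μ δ β γ (φ k) + C (lam δ k) * φ k = 0

lemma exists_Eig (hδ : δ ≤ 0) : ∃ φ, Eig μ δ β γ φ := by
  choose φ h1 h2 h3 using fun k => exists_eig (μ := μ) (β := β) (γ := γ) hδ k
  exact ⟨φ, h1, h2, h3⟩

lemma Qp_der2 : derivative (derivative (Qp δ β γ)) = C (2 * δ) := by
  have h2 : (C 2 : ℝ[X]) = 1 + 1 := by rw [← C_1, ← C_add]; norm_num
  simp [Qp, h2]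
  ring

lemma Eig.der {φ : ℕ → ℝ[X]} (E : Eig μ δ β γ φ) (k i : ℕ) :
    Qp δ β γ * derivative^[i + 2] (φ k) + (C μ - X + C (i : ℝ) * derivative (Qp δ β γ)) *
      derivative^[i + 1] (φ k) + C (lam δ k - lam δ i) * derivative^[i] (φ k) = 0 := by
  induction i with
  | zero =>
    have := E.eig k
    unfold Lop at this
    simpa [lam_zero] using this
  | succ i ih =>
    have h := congrArg derivative ih
    simp only [derivative_add, derivative_mul, derivative_sub, derivative_C, derivative_X,
      Qp_der2, ← Function.iterate_succ_apply' derivative, derivative_zero] at h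
    have h3 : C (lam δ k - lam δ (i + 1)) =
      C (lam δ k - lam δ i) - (1 : ℝ[X]) + C (i : ℝ) * C (2 * δ) := by
      rw [← C_1, ← C_mul, ← C_sub, ← C_add, lam_succ]; congr 1; ring
    rw [h3]
    have h4 : C ((i + 1 : ℕ) : ℝ) = C (i : ℝ) + (1 : ℝ[X]) := by simp
    rw [h4]
    linear_combination h

lemma Eig.der_eval {φ : ℕ → ℝ[X]} (E : Eig μ δ β γ φ) (k i : ℕ) (x : ℝ) :
    (x - μ - i * (2 * δ * x + β)) * (derivative^[i + 1] (φ k)).eval x -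
      pq δ β γ x * (derivative^[i + 2] (φ k)).eval x =
      (lam δ k - lam δ i) * (derivative^[i] (φ k)).eval x := by
  have h := congrArg (eval x) (E.der k i)
  simp only [eval_add, eval_mul, eval_sub, eval_C, eval_X, Qp_eval, Qp_der, eval_zero] at h
  linear_combination -h

end

namespace PS
variable {P : Measure ℝ} {f : ℝ → ℝ} {μ δ β γ : ℝ} {J : Set ℝ}
open Polynomial

lemma eig_step (S : PS P f μ δ β γ J) {φ : ℕ → ℝ[X]} (E : Eig μ δ β γ φ) (k i : ℕ)
    {h h' : ℝ → ℝ} (H : FTC J h h')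
    (h1 : Integrable (fun x => pq δ β γ x ^ (i + 1) *
      (h' x * (derivative^[i + 1] (φ k)).eval x)) P)
    (h2 : Integrable (fun x => pq δ β γ x ^ (i + 1) *
      (h x * (derivative^[i + 2] (φ k)).eval x)) P) :
    ∫ x, pq δ β γ x ^ (i + 1) * (h' x * (derivative^[i + 1] (φ k)).eval x) ∂P =
      (lam δ k - lam δ i) * ∫ x, pq δ β γ x ^ i * (h x * (derivative^[i] (φ k)).eval x) ∂P := by
  have H2 := ftc_poly S.Jc (derivative^[i + 1] (φ k))
  rw [← Function.iterate_succ_apply' derivative] at H2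
  have H3 := FTC.mul S.Jc H H2
  obtain ⟨h3, h4⟩ := S.ibpl i H3 (by
    refine (h1.add h2).congr (ae_of_all _ fun x => ?_)
    simp only [Pi.add_apply]; ring)
  simp only [mul_add] at h4
  rw [integral_add h1 h2] at h4
  rw [← sub_eq_iff_eq_add, ← integral_sub h3 h2] at h4
  rw [← h4, ← integral_const_mul]
  congr 1; ext x
  have := E.der_eval k i x
  unfold Vl
  linear_combination (pq δ β γ x ^ i * h x) * this

end PS
end C1

section C2
namespace PS
variable {P : Measure ℝ} {f : ℝ → ℝ} {μ δ β γ : ℝ} {J : Set ℝ} {φ : ℕ → Polynomial ℝ}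
open Polynomial

lemma qpow_poly2 (S : PS P f μ δ β γ J) (i : ℕ) (p r : ℝ[X]) :
    Integrable (fun x => pq δ β γ x ^ i * (p.eval x * r.eval x)) P := by
  simpa using S.qpow_poly i (p * r)

lemma natDegree_Qp_le : (Qp δ β γ).natDegree ≤ 2 := by
  unfold Qp; compute_degree

lemma natDegree_iter_le (p : ℝ[X]) (i : ℕ) : (derivative^[i] p).natDegree ≤ p.natDegree - i :=
  natDegree_iterate_derivative p i

lemma gd_chain (S : PS P f μ δ β γ J) (E : Eig μ δ β γ φ) (k : ℕ) (gd : ℕ → ℝ → ℝ) (I : ℕ)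
    (H : ∀ i < I, FTC J (gd i) (gd (i + 1)))
    (hI : ∀ i ≤ I, ∀ p : ℝ[X], p.natDegree + i ≤ k →
      Integrable (fun x => pq δ β γ x ^ i * (gd i x * p.eval x)) P) :
    ∫ x, pq δ β γ x ^ I * (gd I x * (derivative^[I] (φ k)).eval x) ∂P =
      Lam δ k I * ∫ x, gd 0 x * (φ k).eval x ∂P := by
  induction I with
  | zero => simp [Lam_zero]
  | succ i ih =>
    have ih := ih (fun j hj => H j (by omega)) (fun j hj => hI j (by omega))
    rw [S.eig_step E k i (H i (by omega)), ih, Lam_succ]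
    · ring
    · by_cases hk : i + 1 ≤ k
      · refine hI (i + 1) le_rfl _ ?_
        have := natDegree_iter_le (φ k) (i + 1)
        rw [E.deg] at this; omega
      · rw [iterate_derivative_eq_zero (by rw [E.deg]; omega)]; simp
    · by_cases hk : i + 2 ≤ k
      · refine (hI i (by omega) (Qp δ β γ * derivative^[i + 2] (φ k)) ?_).congr
          (ae_of_all _ fun x => ?_)
        · have := natDegree_iter_le (φ k) (i + 2)
          rw [E.deg] at this
          have h2 := natDegree_mul_le (p := Qp δ β γ) (q := derivative^[i + 2] (φ k))
          have h3 := natDegree_Qp_le (δ := δ) (β := β) (γ := γ)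
          omega
        · simp only [eval_mul, Qp_eval]; ring
      · rw [iterate_derivative_eq_zero (by rw [E.deg]; omega)]; simp

lemma poly_chain (S : PS P f μ δ β γ J) (E : Eig μ δ β γ φ) (k : ℕ) (p : ℝ[X]) (i : ℕ) :
    ∫ x, pq δ β γ x ^ i * ((derivative^[i] p).eval x * (derivative^[i] (φ k)).eval x) ∂P =
      Lam δ k i * ∫ x, p.eval x * (φ k).eval x ∂P := by
  refine S.gd_chain E k (fun j x => (derivative^[j] p).eval x) i (fun j _ => ?_)
    (fun j _ r _ => S.qpow_poly2 j _ r)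
  have := ftc_poly S.Jc (derivative^[j] p)
  rwa [← Function.iterate_succ_apply' derivative] at this

lemma low_orth (S : PS P f μ δ β γ J) (E : Eig μ δ β γ φ) {k : ℕ} {p : ℝ[X]}
    (hp : p.natDegree < k) : ∫ x, p.eval x * (φ k).eval x ∂P = 0 := by
  have h := S.poly_chain E k p k
  rw [iterate_derivative_eq_zero hp] at h
  simp only [eval_zero, zero_mul, mul_zero, integral_zero] at h
  exact (mul_eq_zero.1 h.symm).resolve_left (Lam_pos S.hδ le_rfl).ne'

lemma orth (S : PS P f μ δ β γ J) (E : Eig μ δ β γ φ) {k l : ℕ} (h : k ≠ l) :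
    ∫ x, (φ k).eval x * (φ l).eval x ∂P = 0 := by
  rcases lt_or_gt_of_ne h with h | h
  · exact S.low_orth E (by rwa [E.deg])
  · have := S.low_orth E (k := k) (p := φ l) (by rwa [E.deg])
    simpa only [mul_comm] using this

lemma der_top (E : Eig μ δ β γ φ) (k : ℕ) : derivative^[k] (φ k) = C (k.factorial : ℝ) := by
  have h0 : (derivative^[k] (φ k)).natDegree = 0 := by
    have := natDegree_iter_le (φ k) k
    rw [E.deg] at this; omega
  rw [eq_C_of_natDegree_eq_zero h0, coeff_iterate_derivative]
  have : (φ k).coeff k = 1 := by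
    have := E.monic k
    rwa [Monic, leadingCoeff, E.deg] at this
  simp [this, Nat.descFactorial_self]

lemma norm_eq (S : PS P f μ δ β γ J) (E : Eig μ δ β γ φ) (k : ℕ) :
    Lam δ k k * ∫ x, (φ k).eval x * (φ k).eval x ∂P =
      (k.factorial : ℝ) ^ 2 * ∫ x, pq δ β γ x ^ k ∂P := by
  rw [← S.poly_chain E k (φ k) k, der_top E k, ← integral_const_mul]
  congr 1; ext x; simp; ring

lemma norm_pos (S : PS P f μ δ β γ J) (E : Eig μ δ β γ φ) (k : ℕ) :
    0 < ∫ x, (φ k).eval x * (φ k).eval x ∂P := by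
  have h := S.norm_eq E k
  have h1 := Lam_pos S.hδ (le_refl k)
  have h2 := S.Epos k
  have h3 : (0:ℝ) < (k.factorial : ℝ) := by exact_mod_cast k.factorial_pos
  have : 0 < Lam δ k k * ∫ x, (φ k).eval x * (φ k).eval x ∂P := by rw [h]; positivity
  exact pos_of_mul_pos_right this h1.le

end PS

/-- normalized squared Fourier coefficient -/
def fe (P : Measure ℝ) (φ : ℕ → Polynomial ℝ) (g : ℝ → ℝ) (k : ℕ) : ℝ :=
  (∫ x, g x * (φ k).eval x ∂P) ^ 2 / ∫ x, (φ k).eval x * (φ k).eval x ∂P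

namespace PS
variable {P : Measure ℝ} {f : ℝ → ℝ} {μ δ β γ : ℝ} {J : Set ℝ} {φ : ℕ → Polynomial ℝ}
open Polynomial

lemma fe_nonneg (S : PS P f μ δ β γ J) (E : Eig μ δ β γ φ) (g : ℝ → ℝ) (k : ℕ) :
    0 ≤ fe P φ g k := div_nonneg (sq_nonneg _) (S.norm_pos E k).le

lemma mean_sq (S : PS P f μ δ β γ J) (E : Eig μ δ β γ φ) (k : ℕ) (gd : ℕ → ℝ → ℝ)
    (H : ∀ i < k, FTC J (gd i) (gd (i + 1)))
    (hI : ∀ i ≤ k, ∀ p : ℝ[X], p.natDegree + i ≤ k →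
      Integrable (fun x => pq δ β γ x ^ i * (gd i x * p.eval x)) P) :
    (∫ x, pq δ β γ x ^ k * gd k x ∂P) ^ 2 =
      Lam δ k k * (∫ x, pq δ β γ x ^ k ∂P) * fe P φ (gd 0) k := by
  have h := S.gd_chain E k gd k H hI
  rw [der_top E k] at h
  have e : ∀ x, pq δ β γ x ^ k * (gd k x * (C (k.factorial : ℝ)).eval x) =
    (k.factorial : ℝ) * (pq δ β γ x ^ k * gd k x) := fun x => by simp; ring
  simp only [e] at h
  rw [integral_const_mul] at h
  have hN := S.norm_eq E k
  have hp := S.norm_pos E k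
  have h3 : (k.factorial : ℝ) ≠ 0 := by exact_mod_cast k.factorial_ne_zero
  unfold fe
  set N := ∫ x, (φ k).eval x * (φ k).eval x ∂P
  set c := ∫ x, gd 0 x * (φ k).eval x ∂P
  set M := ∫ x, pq δ β γ x ^ k * gd k x ∂P
  set A := ∫ x, pq δ β γ x ^ k ∂P
  rw [← mul_div_assoc, eq_div_iff hp.ne']
  have h4 : (k.factorial : ℝ) ^ 2 * (M ^ 2 * N) = (k.factorial : ℝ) ^ 2 * (Lam δ k k * A * c ^ 2) := by
    calc _ = ((k.factorial : ℝ) * M) ^ 2 * N := by ring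
      _ = (Lam δ k k * c) ^ 2 * N := by rw [h]
      _ = (Lam δ k k * N) * (Lam δ k k * c ^ 2) := by ring
      _ = _ := by rw [hN]; ring
  exact mul_left_cancel₀ (pow_ne_zero 2 h3) h4

end PS
end C2

section E1
lemma interior_of_exp_abs {ν : Measure ℝ} {t : ℝ}
    (h : Integrable (fun x : ℝ => Real.exp (t * |x|)) ν) :
    Set.Ioo (-t) t ⊆ interior (integrableExpSet id ν) := by
  refine interior_maximal (fun s hs => ?_) isOpen_Ioo
  simp only [integrableExpSet, Set.mem_ofPred_eq, id]
  refine h.mono' (by fun_prop) (ae_of_all _ fun x => ?_)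
  rw [Real.norm_eq_abs, abs_of_pos (Real.exp_pos _), Real.exp_le_exp]
  have h1 : |s| ≤ t := abs_le.2 ⟨hs.1.le, hs.2.le⟩
  calc s * x ≤ |s * x| := le_abs_self _
    _ = |s| * |x| := abs_mul _ _
    _ ≤ t * |x| := by gcongr

lemma measure_ext_moments {μ₁ μ₂ : Measure ℝ} [IsFiniteMeasure μ₁] [IsFiniteMeasure μ₂] {t : ℝ}
    (ht : 0 < t) (h1 : Integrable (fun x : ℝ => Real.exp (t * |x|)) μ₁)
    (h2 : Integrable (fun x : ℝ => Real.exp (t * |x|)) μ₂)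
    (hm : ∀ k : ℕ, ∫ x, x ^ k ∂μ₁ = ∫ x, x ^ k ∂μ₂) : μ₁ = μ₂ := by
  have s1 := interior_of_exp_abs h1
  have s2 := interior_of_exp_abs h2
  have h0 : (0 : ℝ) ∈ Set.Ioo (-t) t := ⟨by linarith, ht⟩
  set U : Set ℂ := {z | z.re ∈ Set.Ioo (-t) t} with hU
  have a1 : AnalyticOnNhd ℂ (complexMGF id μ₁) U :=
    analyticOnNhd_complexMGF.mono fun z hz => s1 hz
  have a2 : AnalyticOnNhd ℂ (complexMGF id μ₂) U :=
    analyticOnNhd_complexMGF.mono fun z hz => s2 hz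
  have h0U : (0 : ℂ) ∈ U := by simpa [hU] using ht
  have hpre : IsPreconnected U :=
    ((convex_Ioo (-t) t).linear_preimage Complex.reLm).isPreconnected
  have hev : complexMGF id μ₁ =ᶠ[nhds 0] complexMGF id μ₂ := by
    have p1 := (a1 0 h0U).hasFPowerSeriesAt
    have p2 := (a2 0 h0U).hasFPowerSeriesAt
    have e : ∀ n, iteratedDeriv n (complexMGF id μ₁) 0 = iteratedDeriv n (complexMGF id μ₂) 0 := by
      intro n
      rw [iteratedDeriv_complexMGF (s1 (by simpa using h0)), iteratedDeriv_complexMGF (s2 (by simpa using h0))]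
      have := hm n
      simp only [zero_mul, Complex.exp_zero, mul_one, id]
      have r1 : ∀ ν : Measure ℝ, ∫ x, (x : ℂ) ^ n ∂ν = ((∫ x, x ^ n ∂ν : ℝ) : ℂ) := by
        intro ν
        have := integral_ofReal (𝕜 := ℂ) (f := fun x : ℝ => x ^ n) (μ := ν)
        simpa using this
      rw [r1, r1, this]
    simp only [e] at p1
    have := (p1.sub p2)
    rw [sub_self] at this
    filter_upwards [this.eventually_eq_zero] with z hz
    exact sub_eq_zero.1 hz
  have heq := a1.eqOn_of_preconnected_of_eventuallyEq a2 hpre h0U hev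
  refine Measure.ext_of_charFun ?_
  ext s
  rw [← complexMGF_id_mul_I, ← complexMGF_id_mul_I]
  exact heq (by simpa [hU] using ht)

lemma complete_of_exp {ν : Measure ℝ} [IsFiniteMeasure ν] {t : ℝ} (ht : 0 < t)
    (h1 : Integrable (fun x : ℝ => Real.exp (t * |x|)) ν) {h : ℝ → ℝ}
    (hm : AEStronglyMeasurable h ν) (h2 : Integrable (fun x => h x ^ 2) ν)
    (h0 : ∀ k : ℕ, ∫ x, h x * x ^ k ∂ν = 0) : h =ᵐ[ν] 0 := by
  have hI0 : Integrable h ν := by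
    refine (h2.add (integrable_const 1)).mono' hm (ae_of_all _ fun x => ?_)
    simp only [Pi.add_apply, Real.norm_eq_abs]
    nlinarith [sq_abs (h x), sq_nonneg (|h x| - 1)]
  have hexp : Integrable (fun x => |h x| * Real.exp (t / 2 * |x|)) ν := by
    refine (h2.add h1).mono' (hm.norm.mul (by fun_prop)) (ae_of_all _ fun x => ?_)
    have e : Real.exp (t * |x|) = Real.exp (t / 2 * |x|) ^ 2 := by
      rw [← Real.exp_nat_mul]; congr 1; push_cast; ring
    simp only [Pi.add_apply, Real.norm_eq_abs, e]
    rw [abs_mul, abs_abs, abs_of_pos (Real.exp_pos _)]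
    nlinarith [sq_abs (h x), sq_nonneg (|h x| - Real.exp (t / 2 * |x|)), sq_nonneg (|h x|),
      sq_nonneg (Real.exp (t / 2 * |x|))]
  have main : ∀ k : ℝ → ℝ, AEStronglyMeasurable k ν → (∀ x, |max (k x) 0| ≤ |h x|) →
      IsFiniteMeasure (ν.withDensity fun x => ENNReal.ofReal (k x)) ∧
      Integrable (fun x : ℝ => Real.exp (t / 2 * |x|))
        (ν.withDensity fun x => ENNReal.ofReal (k x)) ∧
      (∀ r : ℕ, ∫ x, x ^ r ∂(ν.withDensity fun x => ENNReal.ofReal (k x)) =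
        ∫ x, max (k x) 0 * x ^ r ∂ν) ∧
      (∀ r : ℕ, Integrable (fun x => max (k x) 0 * x ^ r) ν) := by
    intro k hk hkb
    have hkm : AEMeasurable (fun x => ENNReal.ofReal (k x)) ν := hk.aemeasurable.ennreal_ofReal
    have hmax : AEStronglyMeasurable (fun x => max (k x) 0) ν :=
      (hk.aemeasurable.max aemeasurable_const).aestronglyMeasurable
    have hkint : Integrable (fun x => max (k x) 0) ν :=
      hI0.abs.mono' hmax (ae_of_all _ fun x => hkb x)
    have i1 : Integrable (fun x : ℝ => Real.exp (t / 2 * |x|))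
        (ν.withDensity fun x => ENNReal.ofReal (k x)) := by
      rw [integrable_withDensity_iff_integrable_smul₀' hkm (by simp)]
      refine hexp.mono' ?_ (ae_of_all _ fun x => ?_)
      · exact (hkm.ennreal_toReal.aestronglyMeasurable).smul (by fun_prop)
      · rw [smul_eq_mul, norm_mul, ENNReal.toReal_ofReal', Real.norm_eq_abs, Real.norm_eq_abs,
          abs_of_pos (Real.exp_pos _)]
        exact mul_le_mul_of_nonneg_right (hkb x) (Real.exp_pos _).le
    have i0 : IsFiniteMeasure (ν.withDensity fun x => ENNReal.ofReal (k x)) := by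
      refine isFiniteMeasure_withDensity ?_
      have := hkint.lintegral_lt_top
      refine ne_of_lt (lt_of_le_of_lt (lintegral_mono fun x => ?_) this)
      exact ENNReal.ofReal_le_ofReal (le_max_left _ _)
    refine ⟨i0, i1, fun r => ?_, fun r => ?_⟩
    · rw [integral_withDensity_eq_integral_toReal_smul₀ hkm (by simp)]
      simp only [ENNReal.toReal_ofReal', smul_eq_mul]
    · have hin := interior_of_exp_abs i1 (show (0:ℝ) ∈ _ from ⟨by linarith, by linarith⟩)
      have := integrable_pow_of_mem_interior_integrableExpSet hin r
      simp only [id] at this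
      rw [integrable_withDensity_iff_integrable_smul₀' hkm (by simp)] at this
      simpa only [ENNReal.toReal_ofReal', smul_eq_mul] using this
  obtain ⟨f1, e1, m1, i1⟩ := main h hm (fun x => by
    rw [abs_of_nonneg (le_max_right _ _)]; exact max_le (le_abs_self _) (abs_nonneg _))
  obtain ⟨f2, e2, m2, i2⟩ := main (fun x => - h x) hm.neg (fun x => by
    rw [abs_of_nonneg (le_max_right _ _)]; exact max_le (neg_le_abs _) (abs_nonneg _))
  have heq := measure_ext_moments (half_pos ht) e1 e2 (fun k => by
    rw [m1, m2, ← sub_eq_zero, ← integral_sub (i1 k) (i2 k)]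
    refine Eq.trans ?_ (h0 k)
    congr 1; ext x
    rw [← sub_mul]; congr 1
    rcases le_total (h x) 0 with hx | hx
    · rw [max_eq_right hx, max_eq_left (by linarith)]; ring
    · rw [max_eq_left hx, max_eq_right (by linarith)]; ring)
  have hm' : AEMeasurable (fun x => -h x) ν := hm.aemeasurable.neg
  rw [withDensity_eq_iff hm.aemeasurable.ennreal_ofReal hm'.ennreal_ofReal ?_] at heq
  · filter_upwards [heq] with x hx
    have := congrArg ENNReal.toReal hx
    rw [ENNReal.toReal_ofReal', ENNReal.toReal_ofReal'] at this
    rcases le_total (h x) 0 with h | h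
    · rw [max_eq_right h, max_eq_left (by linarith)] at this
      simp only [Pi.zero_apply]; linarith
    · rw [max_eq_left h, max_eq_right (by linarith)] at this
      simpa using this
  · exact (hI0.lintegral_lt_top).ne

namespace PS
variable {P : Measure ℝ} {f : ℝ → ℝ} {μ δ β γ : ℝ} {J : Set ℝ}
open Polynomial

lemma cpow (S : PS P f μ δ β γ J) (i : ℕ) : Integrable (fun x : ℝ => (x - μ) ^ i) P := by
  exact (S.poly ((X - C μ) ^ i)).congr (ae_of_all _ fun x => by simp)

lemma cmom_step (S : PS P f μ δ β γ J) : ∃ K : ℝ, 0 ≤ K ∧ ∀ j : ℕ,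
    ∫ x, (x - μ) ^ (2 * (j + 1)) ∂P ≤ K * ((2 * j + 1) * (2 * j + 2)) *
      ∫ x, (x - μ) ^ (2 * j) ∂P := by
  set A := |β| * |μ| + |γ| with hA
  have hA0 : 0 ≤ A := by positivity
  refine ⟨2 * A + β ^ 2, by positivity, fun j => ?_⟩
  have H : FTC J (fun x : ℝ => (x - μ) ^ (2 * j + 1))
      (fun x : ℝ => ((2 * j + 1 : ℕ) : ℝ) * (x - μ) ^ (2 * j)) :=
    FTC.of_hasDerivAt S.Jc (fun x _ => by
      simpa using ((hasDerivAt_id x).sub_const μ).fun_pow (2 * j + 1)) (by fun_prop)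
  have hI0 : Integrable (fun x => pq δ β γ x * (((2 * j + 1 : ℕ) : ℝ) * (x - μ) ^ (2 * j))) P := by
    have := S.poly (Qp δ β γ * (C ((2 * j + 1 : ℕ) : ℝ) * (X - C μ) ^ (2 * j)))
    refine this.congr (ae_of_all _ fun x => ?_)
    simp [Qp_eval]
  have h1 := (S.ibp H hI0).2
  have e1 : ∀ x : ℝ, (x - μ) * (x - μ) ^ (2 * j + 1) = (x - μ) ^ (2 * (j + 1)) := fun x => by ring
  simp only [e1] at h1
  have hb : Integrable (fun x => (2 * j + 1) * A * (x - μ) ^ (2 * j) +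
      (1 / 2 * (x - μ) ^ (2 * (j + 1)) + β ^ 2 * (2 * j + 1) ^ 2 / 2 * (x - μ) ^ (2 * j))) P :=
    ((S.cpow _).const_mul _).add (((S.cpow _).const_mul _).add ((S.cpow _).const_mul _))
  have h2 : ∫ x, pq δ β γ x * (((2 * j + 1 : ℕ) : ℝ) * (x - μ) ^ (2 * j)) ∂P ≤
      ∫ x, ((2 * j + 1) * A * (x - μ) ^ (2 * j) +
      (1 / 2 * (x - μ) ^ (2 * (j + 1)) + β ^ 2 * (2 * j + 1) ^ 2 / 2 * (x - μ) ^ (2 * j))) ∂P := by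
    refine integral_mono hI0 hb fun x => ?_
    have hq : pq δ β γ x ≤ A + |β| * |x - μ| := by
      have := S.q_le x
      have h3 : |x| ≤ |x - μ| + |μ| := by
        have := abs_add_le (x - μ) μ
        simpa using this
      have : |β| * |x| ≤ |β| * (|x - μ| + |μ|) := by gcongr
      rw [hA]; linarith
    have hp : 0 ≤ (x - μ) ^ (2 * j) := by rw [pow_mul]; positivity
    have hsplit : (x - μ) ^ (2 * (j + 1)) = (x - μ) ^ (2 * j) * (x - μ) ^ 2 := by ring
    simp only [hsplit]
    have hkey : pq δ β γ x * (2 * j + 1) ≤ (2 * j + 1) * A + (1 / 2 * (x - μ) ^ 2 +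
        β ^ 2 * (2 * j + 1) ^ 2 / 2) := by
      have hj : (0:ℝ) ≤ 2 * j + 1 := by positivity
      have h5 : pq δ β γ x * (2 * j + 1) ≤ (A + |β| * |x - μ|) * (2 * j + 1) := by gcongr
      nlinarith [sq_nonneg (|x - μ| - |β| * (2 * j + 1)), sq_abs (x - μ), sq_abs β]
    push_cast
    nlinarith
  have j1 : Integrable (fun x => (2 * j + 1) * A * (x - μ) ^ (2 * j)) P := (S.cpow _).const_mul _
  have j2 : Integrable (fun x => 1 / 2 * (x - μ) ^ (2 * (j + 1))) P := (S.cpow _).const_mul _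
  have j3 : Integrable (fun x => β ^ 2 * (2 * j + 1) ^ 2 / 2 * (x - μ) ^ (2 * j)) P :=
    (S.cpow _).const_mul _
  have j23 : Integrable (fun x => 1 / 2 * (x - μ) ^ (2 * (j + 1)) +
    β ^ 2 * (2 * j + 1) ^ 2 / 2 * (x - μ) ^ (2 * j)) P := j2.add j3
  rw [integral_add j1 j23, integral_add j2 j3, integral_const_mul,
    integral_const_mul, integral_const_mul, ← h1] at h2
  have hM : 0 ≤ ∫ x, (x - μ) ^ (2 * j) ∂P :=
    integral_nonneg fun x => by rw [pow_mul]; positivity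
  have hj : (0:ℝ) ≤ j := Nat.cast_nonneg j
  have h6 : ∫ x, (x - μ) ^ (2 * (j + 1)) ∂P ≤ (2 * A * (2 * j + 1) + β ^ 2 * (2 * j + 1) ^ 2) *
    ∫ x, (x - μ) ^ (2 * j) ∂P := by linarith
  refine h6.trans ?_
  gcongr
  have : 0 ≤ β ^ 2 := sq_nonneg _
  nlinarith [mul_nonneg hA0 hj, mul_nonneg this hj, mul_nonneg (mul_nonneg hA0 hj) hj]

lemma cmom (S : PS P f μ δ β γ J) : ∃ K : ℝ, 0 ≤ K ∧ ∀ j : ℕ,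
    ∫ x, (x - μ) ^ (2 * j) ∂P ≤ K ^ j * (2 * j).factorial := by
  have := S.prob
  obtain ⟨K, hK, h⟩ := S.cmom_step
  refine ⟨K, hK, fun j => ?_⟩
  induction j with
  | zero => simp
  | succ j ih =>
    refine (h j).trans ?_
    have : ((2 * (j + 1)).factorial : ℝ) = (2 * j + 2) * ((2 * j + 1) * (2 * j).factorial) := by
      rw [show 2 * (j + 1) = 2 * j + 1 + 1 by ring, Nat.factorial_succ, Nat.factorial_succ]
      push_cast; ring
    rw [this]
    calc _ ≤ K * ((2 * j + 1) * (2 * j + 2)) * (K ^ j * (2 * j).factorial) := by gcongr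
      _ = _ := by ring

lemma exp_mom (S : PS P f μ δ β γ J) : ∃ t > 0, Integrable (fun x : ℝ => Real.exp (t * |x|)) P := by
  have := S.prob
  obtain ⟨K, hK, h⟩ := S.cmom
  obtain ⟨t, ht, htK⟩ : ∃ t : ℝ, 0 < t ∧ t ^ 2 * K < 1 := by
    refine ⟨1 / (K + 1), by positivity, ?_⟩
    rw [div_pow, one_pow, div_mul_eq_mul_div, one_mul, div_lt_one (by positivity)]
    nlinarith
  refine ⟨t, ht, ?_⟩
  have hcosh : Integrable (fun x : ℝ => Real.cosh (t * (x - μ))) P := by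
    refine ⟨by fun_prop, ?_⟩
    rw [hasFiniteIntegral_iff_ofReal (ae_of_all _ fun x => (Real.cosh_pos _).le)]
    have e : ∀ x : ℝ, ENNReal.ofReal (Real.cosh (t * (x - μ))) =
        ∑' j : ℕ, ENNReal.ofReal ((t * (x - μ)) ^ (2 * j) / (2 * j).factorial) := by
      intro x
      rw [← ENNReal.ofReal_tsum_of_nonneg, (Real.hasSum_cosh _).tsum_eq]
      · intro j; rw [pow_mul]; positivity
      · exact (Real.hasSum_cosh _).summable
    simp only [e]
    rw [lintegral_tsum (fun j => by fun_prop)]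
    have b : ∀ j : ℕ, ∫⁻ x, ENNReal.ofReal ((t * (x - μ)) ^ (2 * j) / (2 * j).factorial) ∂P ≤
        ENNReal.ofReal ((t ^ 2 * K) ^ j) := by
      intro j
      have hp : Integrable (fun x => (t * (x - μ)) ^ (2 * j) / (2 * j).factorial) P := by
        refine ((S.cpow (2 * j)).const_mul (t ^ (2 * j) / (2 * j).factorial)).congr
          (ae_of_all _ fun x => ?_)
        simp only [mul_pow]; ring
      rw [← ofReal_integral_eq_lintegral_ofReal hp (ae_of_all _ fun x => by
        simp only [Pi.zero_apply]; rw [pow_mul]; positivity)]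
      refine ENNReal.ofReal_le_ofReal ?_
      have e2 : ∀ x : ℝ, (t * (x - μ)) ^ (2 * j) / (2 * j).factorial =
        (t ^ (2 * j) / (2 * j).factorial) * (x - μ) ^ (2 * j) := fun x => by rw [mul_pow]; ring
      simp only [e2]
      rw [integral_const_mul]
      have hf : (0:ℝ) < ((2 * j).factorial : ℝ) := by exact_mod_cast (2 * j).factorial_pos
      calc _ ≤ (t ^ (2 * j) / (2 * j).factorial) * (K ^ j * (2 * j).factorial) := by
            gcongr; exact h j
        _ = _ := by field_simp; ring
    refine lt_of_le_of_lt (ENNReal.tsum_le_tsum b) ?_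
    rw [← ENNReal.ofReal_tsum_of_nonneg (fun j => by positivity)
      (summable_geometric_of_lt_one (by positivity) htK)]
    exact ENNReal.ofReal_lt_top
  refine (hcosh.const_mul (2 * Real.exp (t * |μ|))).mono' (by fun_prop) (ae_of_all _ fun x => ?_)
  rw [Real.norm_eq_abs, abs_of_pos (Real.exp_pos _)]
  have h1 : |x| ≤ |x - μ| + |μ| := by
    have := abs_add_le (x - μ) μ
    simpa using this
  have h2 : Real.exp (t * |x|) ≤ Real.exp (t * |μ|) * Real.exp (t * |x - μ|) := by
    rw [← Real.exp_add, Real.exp_le_exp]; nlinarith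
  have h3 : Real.exp (t * |x - μ|) ≤ 2 * Real.cosh (t * (x - μ)) := by
    rw [← Real.cosh_abs, abs_mul, abs_of_pos ht, Real.cosh_eq]
    have := Real.exp_pos (-(t * |x - μ|))
    linarith
  nlinarith [Real.exp_pos (t * |μ|)]

lemma complete (S : PS P f μ δ β γ J) {h : ℝ → ℝ}
    (hm : AEStronglyMeasurable h P) (h2 : Integrable (fun x => h x ^ 2) P)
    (h0 : ∀ k : ℕ, ∫ x, h x * x ^ k ∂P = 0) : h =ᵐ[P] 0 := by
  have := S.prob
  obtain ⟨t, ht, hi⟩ := S.exp_mom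
  exact complete_of_exp ht hi hm h2 h0

end PS
end E1

section E2
namespace PS
variable {P : Measure ℝ} {f : ℝ → ℝ} {μ δ β γ : ℝ} {J : Set ℝ} {m n : ℕ} {gd : ℕ → ℝ → ℝ}
open Polynomial

lemma memH_ftc (S : PS P f μ δ β γ J) (hg : MemH P (pq δ β γ) J m n gd) :
    ∀ k < max m n, FTC J (gd k) (gd (k + 1)) := by
  obtain ⟨h1, h2, h3, -, -⟩ := hg
  intro k hk
  have hl : 1 ≤ max m n := by omega
  by_cases hk1 : k + 1 < max m n
  · refine FTC.of_hasDerivAt S.Jc (h1 k hk1) ?_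
    by_cases hk2 : k + 1 + 1 < max m n
    · exact fun x hx => ((h1 (k + 1) hk2 x hx).continuousAt).continuousWithinAt
    · have : k + 1 = max m n - 1 := by omega
      rw [this]; exact h2 hl
  · have e : max m n = k + 1 := by omega
    have := h3 hl
    rw [e] at this
    simp only [Nat.add_sub_cancel] at this
    exact this

lemma memH_aesm (S : PS P f μ δ β γ J) (hl : 1 ≤ max m n) (hg : MemH P (pq δ β γ) J m n gd) :
    ∀ k ≤ max m n, AEStronglyMeasurable (gd k) P := by
  intro k hk
  rcases k with _ | k
  · exact S.aesm (FTC.continuousOn S.Jc S.Jo (S.memH_ftc hg 0 (by omega)))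
  · exact S.aesm' (S.memH_ftc hg k (by omega))

lemma memH_l2 (S : PS P f μ δ β γ J) (hg : MemH P (pq δ β γ) J m n gd) :
    ∀ i ≤ n, Integrable (fun x => pq δ β γ x ^ i * gd i x ^ 2) P := by
  intro i hi
  obtain ⟨d, rfl⟩ := Nat.exists_eq_add_of_le hi
  have key : ∀ d', d' ≤ d → Integrable (fun x => pq δ β γ x ^ (i + (d - d')) * gd (i + (d - d')) x ^ 2) P := by
    intro d'
    induction d' with
    | zero => intro _; exact hg.2.2.2.1
    | succ d' ih =>
      intro h
      have := ih (by omega)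
      rw [show i + (d - d') = i + (d - (d' + 1)) + 1 by omega] at this
      exact S.hardy2l _ (S.memH_ftc hg _ (by omega)) this
  simpa using key d le_rfl

lemma memH_int1 (S : PS P f μ δ β γ J) (hg : MemH P (pq δ β γ) J m n gd) :
    ∀ d i, n < i → i + d = m → ∀ s ≤ d, Integrable (fun x => pq δ β γ x ^ i * (gd i x * x ^ s)) P := by
  intro d
  induction d with
  | zero =>
    intro i hi hm s hs
    obtain rfl : s = 0 := by omega
    have h0 := hg.2.2.2.2 i hi (by omega)
    have hm' := S.memH_aesm (by omega) hg i (by omega)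
    refine h0.mono' ?_ ?_
    · exact ((S.aesm ((pq_cont (δ := δ) (β := β) (γ := γ)).pow i).continuousOn)).mul (by simpa using hm')
    · filter_upwards [S.aeJ] with x hx
      have := S.qpos hx
      simp only [pow_zero, mul_one, norm_mul, norm_pow, Real.norm_eq_abs, abs_of_pos this]
      exact le_rfl
  | succ d ih =>
    intro i hi hm s hs
    exact S.hardyWl i (S.memH_ftc hg i (by omega)) d (ih (i + 1) (by omega) (by omega)) s hs

lemma memH_intn (S : PS P f μ δ β γ J) (hl : 1 ≤ max m n) (hg : MemH P (pq δ β γ) J m n gd) :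
    ∀ i ≤ n, ∀ p : ℝ[X], Integrable (fun x => pq δ β γ x ^ i * (gd i x * p.eval x)) P :=
  fun i hi p => S.l2poly i (S.memH_aesm hl hg i (by omega)) (S.memH_l2 hg i hi) p

lemma memH_int (S : PS P f μ δ β γ J) (hl : 1 ≤ max m n) (hg : MemH P (pq δ β γ) J m n gd)
    {k : ℕ} (hk : k ≤ m) :
    ∀ i ≤ k, ∀ p : ℝ[X], p.natDegree + i ≤ k →
      Integrable (fun x => pq δ β γ x ^ i * (gd i x * p.eval x)) P := by
  intro i hi p hp
  by_cases hin : i ≤ n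
  · exact S.memH_intn hl hg i hin p
  · have h1 := S.memH_int1 hg (m - i) i (by omega) (by omega)
    have h2 : Integrable (fun x => ∑ s ∈ range (p.natDegree + 1),
        p.coeff s * (pq δ β γ x ^ i * (gd i x * x ^ s))) P :=
      integrable_finsetSum _ fun s hs => (h1 s (by have := Finset.mem_range.1 hs; omega)).const_mul _
    refine h2.congr (ae_of_all _ fun x => ?_)
    simp only [eval_eq_sum_range, Finset.mul_sum]
    exact Finset.sum_congr rfl fun s _ => by ring

end PS

open Polynomial in
lemma parseval_poly {ν : Measure ℝ} [IsProbabilityMeasure ν] {ψ : ℕ → ℝ[X]}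
    (hp : ∀ p : ℝ[X], Integrable (fun x => p.eval x) ν)
    (hdeg : ∀ k, (ψ k).natDegree ≤ k) (hc : ∀ k, (ψ k).coeff k ≠ 0)
    (horth : ∀ k l, k ≠ l → ∫ x, (ψ k).eval x * (ψ l).eval x ∂ν = 0)
    (hpos : ∀ k, 0 < ∫ x, (ψ k).eval x * (ψ k).eval x ∂ν)
    (hcomp : ∀ h : ℝ → ℝ, AEStronglyMeasurable h ν → Integrable (fun x => h x ^ 2) ν →
      (∀ k : ℕ, ∫ x, h x * x ^ k ∂ν = 0) → h =ᵐ[ν] 0)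
    {h : ℝ → ℝ} (hm : AEStronglyMeasurable h ν) (h2 : Integrable (fun x => h x ^ 2) ν) :
    HasSum (fun k => (∫ x, h x * (ψ k).eval x ∂ν) ^ 2 / ∫ x, (ψ k).eval x * (ψ k).eval x ∂ν)
      (∫ x, h x ^ 2 ∂ν) := by
  have hL : ∀ p : ℝ[X], MemLp (fun x => p.eval x) 2 ν := fun p => by
    rw [memLp_two_iff_integrable_sq (by fun_prop)]
    exact (hp (p ^ 2)).congr (ae_of_all _ fun x => by simp)
  have hh : MemLp h 2 ν := by rwa [memLp_two_iff_integrable_sq hm]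
  have inn : ∀ (u w : ℝ → ℝ) (hu : MemLp u 2 ν) (hw : MemLp w 2 ν),
      inner ℝ (hu.toLp u) (hw.toLp w) = ∫ x, u x * w x ∂ν := by
    intro u w hu hw
    rw [L2.inner_def]
    refine integral_congr_ae ?_
    filter_upwards [hu.coeFn_toLp, hw.coeFn_toLp] with x h1 h2
    simp [h1, h2, mul_comm]
  set N : ℕ → ℝ := fun k => ∫ x, (ψ k).eval x * (ψ k).eval x ∂ν with hN
  set v : ℕ → Lp ℝ 2 ν := fun k => (Real.sqrt (N k))⁻¹ • (hL (ψ k)).toLp _ with hv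
  have sN : ∀ k, 0 < Real.sqrt (N k) := fun k => Real.sqrt_pos.2 (hpos k)
  have ortho : Orthonormal ℝ v := by
    rw [orthonormal_iff_ite]
    intro k l
    simp only [hv, real_inner_smul_left, real_inner_smul_right, inn]
    split_ifs with hkl
    · subst hkl
      have : (∫ x, (ψ k).eval x * (ψ k).eval x ∂ν) = Real.sqrt (N k) * Real.sqrt (N k) :=
        (Real.mul_self_sqrt (hpos k).le).symm
      rw [this]
      have := (sN k).ne'
      field_simp
    · rw [horth k l hkl]; simp
  have hbot : (Submodule.span ℝ (Set.range v))ᗮ = ⊥ := by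
    rw [Submodule.eq_bot_iff]
    intro u hu
    have hum : MemLp (fun x => u x) 2 ν := Lp.memLp u
    have hue : hum.toLp _ = u := Lp.toLp_coeFn u hum
    have h0 : ∀ k, ∫ x, u x * (ψ k).eval x ∂ν = 0 := by
      intro k
      have h1 := (Submodule.mem_orthogonal _ u).1 hu (v k) (Submodule.subset_span ⟨k, rfl⟩)
      rw [hv, ← hue] at h1
      simp only [real_inner_smul_left, inn] at h1
      have h3 := (mul_eq_zero.1 h1).resolve_left (inv_ne_zero (sN k).ne')
      rw [← h3]; congr 1; ext x; ring
    have ui : ∀ p : ℝ[X], Integrable (fun x => u x * p.eval x) ν := fun p => hum.integrable_mul (hL p)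
    have hall : ∀ d : ℕ, ∀ p : ℝ[X], p.degree < d → ∫ x, u x * p.eval x ∂ν = 0 := by
      intro d
      induction d with
      | zero =>
        intro p hp
        have : p = 0 := by simpa [Polynomial.degree_lt_iff_coeff_zero, Polynomial.ext_iff] using hp
        simp [this]
      | succ d ih =>
        intro p hpd
        set c := p.coeff d / (ψ d).coeff d with hcdef
        have h1 := ih (p - C c * ψ d) (by
          rw [Polynomial.degree_lt_iff_coeff_zero] at hpd ⊢
          intro j hj
          rw [coeff_sub, coeff_C_mul]
          rcases hj.eq_or_lt with rfl | hj
          · rw [hcdef, div_mul_cancel₀ _ (hc d), sub_self]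
          · rw [hpd j hj, coeff_eq_zero_of_natDegree_lt (lt_of_le_of_lt (hdeg d) hj)]; simp)
        have e : ∀ x, u x * (p - C c * ψ d).eval x = u x * p.eval x - c * (u x * (ψ d).eval x) := by
          intro x; simp; ring
        simp only [e] at h1
        rw [integral_sub (ui p) ((ui (ψ d)).const_mul c), integral_const_mul, h0] at h1
        linarith
    have hz := hcomp (fun x => u x) hum.1 (by
      rwa [← memLp_two_iff_integrable_sq hum.1]) (fun k => by
        have := hall (k + 1) (X ^ k) (by
          rw [degree_X_pow]; exact_mod_cast Nat.lt_succ_self k)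
        simpa using this)
    exact (Lp.eq_zero_iff_ae_eq_zero).2 hz
  have key := (HilbertBasis.mkOfOrthogonalEqBot ortho hbot).hasSum_inner_mul_inner
    (hh.toLp h) (hh.toLp h)
  rw [inn] at key
  have e2 : ∫ x, h x ^ 2 ∂ν = ∫ x, h x * h x ∂ν := by congr 1; ext x; ring
  rw [e2]
  have e3 : (fun k => (∫ x, h x * (ψ k).eval x ∂ν) ^ 2 /
      ∫ x, (ψ k).eval x * (ψ k).eval x ∂ν) = fun k => inner ℝ (hh.toLp h) (v k) *
        inner ℝ (v k) (hh.toLp h) := by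
    ext k
    simp only [hv, real_inner_smul_left, real_inner_smul_right, inn]
    have e1 : ∫ x, (ψ k).eval x * h x ∂ν = ∫ x, h x * (ψ k).eval x ∂ν := by
      congr 1; ext x; ring
    rw [e1]
    have : (∫ x, (ψ k).eval x * (ψ k).eval x ∂ν) = Real.sqrt (N k) * Real.sqrt (N k) :=
      (Real.mul_self_sqrt (hpos k).le).symm
    rw [this]
    have := (sN k).ne'
    field_simp
  rw [e3]
  rw [HilbertBasis.coe_mkOfOrthogonalEqBot] at key
  exact key

namespace PS
variable {P : Measure ℝ} {f : ℝ → ℝ} {μ δ β γ : ℝ} {J : Set ℝ} {m n : ℕ} {gd : ℕ → ℝ → ℝ}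
variable {φ : ℕ → Polynomial ℝ}
open Polynomial

lemma parseval (S : PS P f μ δ β γ J) (E : Eig μ δ β γ φ) (hl : 1 ≤ max m n)
    (hg : MemH P (pq δ β γ) J m n gd) {i : ℕ} (hi : i ≤ n) :
    HasSum (fun k => Lam δ k i * fe P φ (gd 0) k) (∫ x, pq δ β γ x ^ i * gd i x ^ 2 ∂P) := by
  have T := S.tilt i
  have := T.prob
  set ψ : ℕ → ℝ[X] := fun j => derivative^[i] (φ (j + i)) with hψ
  have Z := S.Epos i
  set z := ∫ y, pq δ β γ y ^ i ∂P with hz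
  have hnn : ∀ k l, ∫ x, (ψ k).eval x * (ψ l).eval x ∂(Ptilt P f δ β γ i) =
      (Lam δ (l + i) i * ∫ x, (φ (k + i)).eval x * (φ (l + i)).eval x ∂P) / z := by
    intro k l
    rw [S.tilt_int, S.poly_chain E (l + i) (φ (k + i)) i]
  have hm : AEStronglyMeasurable (gd i) (Ptilt P f δ β γ i) := by
    rcases i with _ | i
    · exact T.aesm (FTC.continuousOn S.Jc S.Jo (S.memH_ftc hg 0 (by omega)))
    · exact T.aesm' (S.memH_ftc hg i (by omega))
  have h := parseval_poly (ν := Ptilt P f δ β γ i) (ψ := ψ) (fun p => T.poly p)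
    (fun k => by
      refine (natDegree_iterate_derivative _ _).trans ?_
      rw [E.deg]; omega)
    (fun k => by
      rw [hψ, coeff_iterate_derivative]
      have h1 : (φ (k + i)).coeff (k + i) = 1 := by
        have := E.monic (k + i)
        rw [Monic, leadingCoeff, E.deg] at this; exact this
      rw [h1, nsmul_eq_mul, mul_one]
      exact_mod_cast (Nat.descFactorial_pos.2 (by omega)).ne')
    (fun k l hkl => by rw [hnn, S.orth E (by omega)]; simp)
    (fun k => by
      rw [hnn]
      have := S.norm_pos E (k + i)
      have := Lam_pos S.hδ (show i ≤ k + i by omega)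
      positivity)
    (fun h hm h2 h0 => T.complete hm h2 h0) hm
    ((S.tilt_integrable i _).2 (S.memH_l2 hg i hi))
  rw [S.tilt_int, ← hz] at h
  have h' := h.mul_right z
  rw [div_mul_cancel₀ _ Z.ne'] at h'
  have hz0 : ∑ k ∈ range i, Lam δ k i * fe P φ (gd 0) k = 0 :=
    Finset.sum_eq_zero fun k hk => by rw [Lam_eq_zero δ (Finset.mem_range.1 hk), zero_mul]
  rw [← hasSum_nat_add_iff' i, hz0, sub_zero]
  refine (congrArg (fun F => HasSum F _) (funext fun k => ?_)).mpr h'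
  rw [hnn, S.tilt_int, ← hz, S.gd_chain E (k + i) gd i
    (fun j hj => S.memH_ftc hg j (by omega)) (fun j hj p _ => S.memH_intn hl hg j (by omega) p), fe]
  have := S.norm_pos E (k + i)
  have := Lam_pos S.hδ (show i ≤ k + i by omega)
  field_simp

lemma ae_eq_on (S : PS P f μ δ β γ J) {u v : ℝ → ℝ} (hu : ContinuousOn u J) (hv : ContinuousOn v J)
    (h : u =ᵐ[P] v) : ∀ x ∈ J, u x = v x := by
  intro x hx
  by_contra hne
  have hopen : IsOpen (J ∩ {y | u y ≠ v y}) := by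
    have := (hu.sub hv).isOpen_inter_preimage S.Jo (isOpen_compl_singleton (x := (0:ℝ)))
    convert this using 1
    ext y; simp [sub_eq_zero]
  obtain ⟨ε, hε, hb⟩ := Metric.isOpen_iff.1 hopen x ⟨hx, hne⟩
  rw [Real.ball_eq_Ioo] at hb
  refine S.measIoo (show x - ε < x + ε by linarith) (fun y hy => (hb hy).1) ?_
  exact measure_mono_null (fun y hy => (hb hy).2) h

end PS
end E2

section E3
lemma lam_sub (δ x y : ℝ) : x * (1 - (x - 1) * δ) - y * (1 - (y - 1) * δ) =
    (x - y) * (1 - (x + y - 1) * δ) := by ring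

lemma fall_zero (x : ℝ) : fall x 0 = 1 := by simp [fall]
lemma fall_succ (x : ℝ) (k : ℕ) : fall x (k + 1) = fall x k * (x - k) := by
  simp [fall, Finset.prod_range_succ]
lemma fall_add (x : ℝ) (a b : ℕ) : fall x (a + b) = fall x a * fall (x - a) b := by
  unfold fall
  rw [Finset.prod_range_add]
  congr 1
  refine Finset.prod_congr rfl fun j _ => ?_
  push_cast; ring
lemma fall_succ' (x : ℝ) (k : ℕ) : fall (x + 1) (k + 1) = (x + 1) * fall x k := by
  rw [add_comm k 1, fall_add]
  simp [fall]
lemma fall_pos {x : ℝ} {k : ℕ} (h : (k : ℝ) ≤ x) : 0 < fall x k := by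
  refine Finset.prod_pos fun j hj => ?_
  have : (j : ℝ) < k := by exact_mod_cast Finset.mem_range.1 hj
  linarith
lemma fall_choose (m i : ℕ) : (m.choose i : ℝ) * fall i i = fall m i := by
  have h : ∀ m k : ℕ, fall m k = (m.descFactorial k : ℝ) := by
    intro m k
    induction k with
    | zero => simp [fall_zero]
    | succ k ih =>
      rw [fall_succ, ih, Nat.descFactorial_succ]
      rcases le_or_gt k m with h | h
      · push_cast [h]; ring
      · rw [Nat.descFactorial_eq_zero_iff_lt.2 h]; simp
  rw [h, h, Nat.descFactorial_self, Nat.descFactorial_eq_factorial_mul_choose]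
  push_cast; ring

lemma pp_zero (δ a : ℝ) : pp δ a 0 = 1 := by simp [pp]
lemma pp_succ (δ a : ℝ) (k : ℕ) : pp δ a (k + 1) = pp δ a k * (1 - (a + k) * δ) := by
  simp [pp, Finset.prod_range_succ]
lemma pp_pos {δ a : ℝ} (hδ : δ ≤ 0) (ha : 0 ≤ a) (k : ℕ) : 0 < pp δ a k := by
  refine Finset.prod_pos fun j _ => ?_
  have : 0 ≤ a + j := by positivity
  nlinarith

lemma Lam_eq_fall (δ : ℝ) (k i : ℕ) : Lam δ k i = fall k i * pp δ ((k : ℝ) - 1) i := by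
  unfold Lam fall pp
  rw [← Finset.prod_mul_distrib]
  refine Finset.prod_congr rfl fun j _ => ?_
  unfold lam; ring

lemma fall_reflect (x : ℝ) (n : ℕ) : fall (x + n) n = ∏ j ∈ range n, (x + 1 + j) := by
  induction n with
  | zero => simp [fall]
  | succ n ih =>
    have := fall_succ' (x + n) n
    rw [Finset.prod_range_succ, ← ih]
    push_cast
    rw [← add_assoc, this]; ring

/-- the normalising constant -/
def Dc (δ : ℝ) (m n : ℕ) : ℝ := fall ((m : ℝ) + n) n * pp δ (m : ℝ) n

lemma Dc_prod (δ : ℝ) (m n : ℕ) : Dc δ m n = ∏ j ∈ range n, lam δ (m + 1 + j) := by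
  unfold Dc pp
  rw [fall_reflect, ← Finset.prod_mul_distrib]
  refine Finset.prod_congr rfl fun j _ => ?_
  unfold lam; push_cast; ring

lemma lam_pos' {δ : ℝ} (hδ : δ ≤ 0) {k : ℕ} (hk : 0 < k) : 0 < lam δ k := by
  have := lam_strictMono hδ hk
  rwa [lam_zero] at this

lemma Dc_pos {δ : ℝ} (hδ : δ ≤ 0) (m n : ℕ) : 0 < Dc δ m n := by
  rw [Dc_prod]
  exact Finset.prod_pos fun j _ => lam_pos' hδ (by omega)

/-- coefficients -/
def cf (δ : ℝ) (m n i : ℕ) : ℝ := (n.choose i : ℝ) / (fall ((m : ℝ) + n) i * pp δ (m : ℝ) i)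

lemma cf_zero (δ : ℝ) (m n : ℕ) : cf δ m n 0 = 1 := by simp [cf, fall_zero, pp_zero]
lemma cf_top (δ : ℝ) (m n : ℕ) : cf δ m n (n + 1) = 0 := by simp [cf]

lemma cf_step {δ : ℝ} (hδ : δ ≤ 0) (m n i : ℕ) (hi : i ≤ n) :
    cf δ m (n + 1) (i + 1) = cf δ m n (i + 1) * (1 - lam δ (i + 1) / lam δ (m + n + 1)) +
      cf δ m n i / lam δ (m + n + 1) := by
  have hL := lam_pos' hδ (show 0 < m + n + 1 by omega)
  have hLe : lam δ (m + n + 1) = ((m : ℝ) + n + 1) * (1 - (m + n) * δ) := by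
    unfold lam; push_cast; ring
  have h1 : 0 < (m : ℝ) + n + 1 := by positivity
  have h2 : 0 < 1 - ((m : ℝ) + n) * δ := by
    have : 0 ≤ (m : ℝ) + n := by positivity
    nlinarith
  have h3 : 0 < fall ((m : ℝ) + n) i := fall_pos (by
    have : (i : ℝ) ≤ n := by exact_mod_cast hi
    have : (0 : ℝ) ≤ m := by positivity
    linarith)
  have h4 : 0 < pp δ (m : ℝ) i := pp_pos hδ (by positivity) i
  have h5 : 0 < 1 - ((m : ℝ) + i) * δ := by
    have : 0 ≤ (m : ℝ) + i := by positivity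
    nlinarith
  have hf : fall ((m : ℝ) + ((n + 1 : ℕ) : ℝ)) (i + 1) = ((m : ℝ) + n + 1) * fall ((m : ℝ) + n) i := by
    push_cast; rw [← add_assoc, fall_succ']
  have hch : ((n + 1).choose (i + 1) : ℝ) = n.choose i + n.choose (i + 1) := by
    exact_mod_cast Nat.choose_succ_succ n i
  have hch2 : (n.choose (i + 1) : ℝ) * (i + 1) = n.choose i * (n - i) := by
    have := Nat.choose_succ_right_eq n i
    have h' : ((n.choose (i + 1) * (i + 1) : ℕ) : ℝ) = ((n.choose i * (n - i) : ℕ) : ℝ) := by rw [this]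
    push_cast [hi] at h'
    exact h'
  unfold cf
  rw [hf, hch, pp_succ]
  rcases hi.eq_or_lt with rfl | hlt
  · simp only [Nat.choose_succ_self, Nat.choose_self, hLe]
    field_simp
    simp
  · have h6 : 0 < (m : ℝ) + n - i := by
      have : (i : ℝ) < n := by exact_mod_cast hlt
      have : (0 : ℝ) ≤ m := by positivity
      linarith
    rw [fall_succ, hLe]
    have hli : lam δ (i + 1) = ((i : ℝ) + 1) * (1 - i * δ) := by unfold lam; push_cast; ring
    rw [hli]
    field_simp
    linear_combination ((m : ℝ) + n - i) * δ * hch2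

/-- the spectral multiplier -/
def Gm (δ : ℝ) (m n k : ℕ) : ℝ := ∑ i ∈ range (n + 1), (-1 : ℝ) ^ i * cf δ m n i * Lam δ k i

lemma Gm_succ {δ : ℝ} (hδ : δ ≤ 0) (m n k : ℕ) :
    Gm δ m (n + 1) k = (1 - lam δ k / lam δ (m + n + 1)) * Gm δ m n k := by
  set L := lam δ (m + n + 1) with hL
  have hL0 : L ≠ 0 := (lam_pos' hδ (by omega)).ne'
  have e1 : ∑ i ∈ range (n + 1), (-1 : ℝ) ^ i * cf δ m n i * (1 - lam δ i / L) * Lam δ k i =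
      1 + ∑ i ∈ range (n + 1), (-1 : ℝ) ^ (i + 1) * cf δ m n (i + 1) *
        (1 - lam δ (i + 1) / L) * Lam δ k (i + 1) := by
    have h1 := Finset.sum_range_succ (fun i => (-1 : ℝ) ^ i * cf δ m n i * (1 - lam δ i / L) * Lam δ k i)
      (n + 1)
    rw [cf_top] at h1
    have h2 := Finset.sum_range_succ' (fun i => (-1 : ℝ) ^ i * cf δ m n i * (1 - lam δ i / L) * Lam δ k i)
      (n + 1)
    rw [cf_zero, lam_zero, Lam_zero] at h2
    rw [h1] at h2
    simp only [mul_zero, zero_mul, add_zero] at h2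
    rw [h2]; ring
  have e2 : (1 - lam δ k / L) * Gm δ m n k =
      ∑ i ∈ range (n + 1), (-1 : ℝ) ^ i * cf δ m n i * (1 - lam δ i / L) * Lam δ k i -
      ∑ i ∈ range (n + 1), (-1 : ℝ) ^ i * (cf δ m n i / L) * Lam δ k (i + 1) := by
    unfold Gm
    rw [Finset.mul_sum, ← Finset.sum_sub_distrib]
    refine Finset.sum_congr rfl fun i _ => ?_
    rw [Lam_succ]; ring
  rw [e2, e1, Gm, Finset.sum_range_succ', cf_zero, Lam_zero, add_sub_assoc, ← Finset.sum_sub_distrib]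
  rw [add_comm, pow_zero, one_mul, one_mul]
  congr 1
  refine Finset.sum_congr rfl fun i hi => ?_
  rw [cf_step hδ m n i (by have := Finset.mem_range.1 hi; omega), ← hL]
  ring

lemma Gm_eq {δ : ℝ} (hδ : δ ≤ 0) (m n k : ℕ) :
    Dc δ m n * Gm δ m n k = ∏ j ∈ range n, (lam δ (m + 1 + j) - lam δ k) := by
  rw [Dc_prod]
  induction n with
  | zero => simp [Gm, cf_zero, Lam_zero]
  | succ n ih =>
    rw [Gm_succ hδ, Finset.prod_range_succ, Finset.prod_range_succ, ← ih]
    rw [show m + 1 + n = m + n + 1 by ring]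
    have := (lam_pos' hδ (show 0 < m + n + 1 by omega)).ne'
    field_simp

lemma Gm_zero (δ : ℝ) (m n : ℕ) : Gm δ m n 0 = 1 := by
  unfold Gm
  rw [Finset.sum_range_succ', Finset.sum_eq_zero fun i _ => by rw [Lam_eq_zero δ (by omega), mul_zero]]
  simp [cf_zero, Lam_zero]

lemma Gm_low {δ : ℝ} (hδ : δ ≤ 0) (m n i : ℕ) (hi : i ≤ m) :
    (m.choose i : ℝ) * pp δ ((m : ℝ) + i) n * fall i i /
      (fall ((m : ℝ) + n) i * pp δ (m : ℝ) n) = Gm δ m n i := by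
  have hD := Dc_pos hδ m n
  have h := Gm_eq hδ m n i
  have him : (i : ℝ) ≤ m := by exact_mod_cast hi
  have e : ∏ j ∈ range n, (lam δ (m + 1 + j) - lam δ i) =
      fall ((m : ℝ) - i + n) n * pp δ ((m : ℝ) + i) n := by
    rw [fall_reflect]; unfold pp
    rw [← Finset.prod_mul_distrib]
    refine Finset.prod_congr rfl fun j _ => ?_
    unfold lam; push_cast; ring
  rw [e] at h
  have f1 : 0 < fall ((m : ℝ) + n) i := fall_pos (by
    have : (0 : ℝ) ≤ n := by positivity
    linarith)
  have f2 : 0 < fall ((m : ℝ) + n) n := fall_pos (by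
    have : (0 : ℝ) ≤ m := by positivity
    linarith)
  have p1 : 0 < pp δ (m : ℝ) n := pp_pos hδ (by positivity) n
  have hs : fall ((m : ℝ) + n) i * fall ((m : ℝ) - i + n) n = fall ((m : ℝ) + n) n * fall m i := by
    have a := fall_add ((m : ℝ) + n) i n
    have b := fall_add ((m : ℝ) + n) n i
    rw [add_comm n i, a, add_sub_cancel_right] at b
    rw [← b]; congr 2; ring
  have hc := fall_choose m i
  rw [Dc] at h
  rw [div_eq_iff (by positivity)]
  refine mul_left_cancel₀ f2.ne' ?_
  calc fall ((m : ℝ) + n) n * ((m.choose i : ℝ) * pp δ ((m : ℝ) + i) n * fall i i)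
      = (fall ((m : ℝ) + n) n * ((m.choose i : ℝ) * fall i i)) * pp δ ((m : ℝ) + i) n := by ring
    _ = (fall ((m : ℝ) + n) i * fall ((m : ℝ) - i + n) n) * pp δ ((m : ℝ) + i) n := by rw [hc, hs]
    _ = fall ((m : ℝ) + n) i * (fall ((m : ℝ) - i + n) n * pp δ ((m : ℝ) + i) n) := by ring
    _ = _ := by rw [← h]; ring

/-- nonnegative multiplier -/
def Vm (δ : ℝ) (m n k : ℕ) : ℝ :=
  if k ≤ m then 0 else ∏ j ∈ range n, (lam δ k - lam δ (m + 1 + j))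

lemma Vm_zero (δ : ℝ) {m n k : ℕ} (hk : k ≤ m + n) : Vm δ m n k = 0 := by
  unfold Vm
  split_ifs with h
  · rfl
  · refine Finset.prod_eq_zero (i := k - m - 1) (by rw [Finset.mem_range]; omega) ?_
    rw [show m + 1 + (k - m - 1) = k by omega, sub_self]

lemma Vm_pos {δ : ℝ} (hδ : δ ≤ 0) {m n k : ℕ} (hk : m + n < k) : 0 < Vm δ m n k := by
  unfold Vm
  rw [if_neg (by omega)]
  refine Finset.prod_pos fun j hj => sub_pos.2 (lam_strictMono hδ ?_)
  have := Finset.mem_range.1 hj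
  omega

lemma Vm_nonneg {δ : ℝ} (hδ : δ ≤ 0) (m n k : ℕ) : 0 ≤ Vm δ m n k := by
  rcases le_or_gt k (m + n) with h | h
  · rw [Vm_zero δ h]
  · exact (Vm_pos hδ h).le

lemma Vm_lt {δ : ℝ} (hδ : δ ≤ 0) {m₁ m₂ n k : ℕ} (hn : 1 ≤ n) (hm : m₁ < m₂) (hk : m₁ + n < k) :
    Vm δ m₂ n k < Vm δ m₁ n k := by
  rcases le_or_gt k (m₂ + n) with h | h
  · rw [Vm_zero δ h]; exact Vm_pos hδ hk
  · unfold Vm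
    rw [if_neg (by omega), if_neg (by omega)]
    refine Finset.prod_lt_prod_of_nonempty (fun j hj => ?_) (fun j hj => ?_)
      ⟨0, Finset.mem_range.2 hn⟩
    · refine sub_pos.2 (lam_strictMono hδ ?_)
      have := Finset.mem_range.1 hj
      omega
    · exact sub_lt_sub_left (lam_strictMono hδ (by omega)) _

lemma Vm_le {δ : ℝ} (hδ : δ ≤ 0) {m₁ m₂ n : ℕ} (hn : 1 ≤ n) (hm : m₁ < m₂) (k : ℕ) :
    Vm δ m₂ n k ≤ Vm δ m₁ n k := by
  rcases le_or_gt k (m₁ + n) with h | h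
  · rw [Vm_zero δ h, Vm_zero δ (by omega)]
  · exact (Vm_lt hδ hn hm h).le

lemma zeta_eq (δ : ℝ) (m₁ m₂ n : ℕ) : zeta δ m₁ m₂ n = Dc δ m₂ n / Dc δ m₁ n := rfl

lemma Dc_lt {δ : ℝ} (hδ : δ ≤ 0) {m₁ m₂ n : ℕ} (hn : 1 ≤ n) (hm : m₁ < m₂) :
    Dc δ m₁ n < Dc δ m₂ n := by
  rw [Dc_prod, Dc_prod]
  exact Finset.prod_lt_prod_of_nonempty (fun j _ => lam_pos' hδ (by omega))
    (fun j _ => lam_strictMono hδ (by omega)) ⟨0, Finset.mem_range.2 hn⟩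

lemma Vm_Gm {δ : ℝ} (hδ : δ ≤ 0) (m n k : ℕ) (hk : m < k) :
    (-1) ^ n * Dc δ m n * Gm δ m n k = Vm δ m n k := by
  rw [mul_assoc, Gm_eq hδ, Vm, if_neg (by omega)]
  have : ((-1 : ℝ)) ^ n = ∏ _j ∈ range n, (-1 : ℝ) := by simp
  rw [this, ← Finset.prod_mul_distrib]
  exact Finset.prod_congr rfl fun j _ => by ring
end E3

section E4
namespace PS
variable {P : Measure ℝ} {f : ℝ → ℝ} {μ δ β γ : ℝ} {J : Set ℝ} {m n : ℕ} {gd : ℕ → ℝ → ℝ}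
variable {φ : ℕ → Polynomial ℝ}
open Polynomial

lemma eig_zero (E : Eig μ δ β γ φ) : φ 0 = 1 :=
  (E.monic 0).natDegree_eq_zero.1 (E.deg 0)

lemma var_eq (S : PS P f μ δ β γ J) (E : Eig μ δ β γ φ) (hl : 1 ≤ max m n)
    (hg : MemH P (pq δ β γ) J m n gd) :
    variance (gd 0) P = ∫ x, pq δ β γ x ^ 0 * gd 0 x ^ 2 ∂P - fe P φ (gd 0) 0 := by
  have := S.prob
  have hm := S.memH_aesm hl hg 0 (by omega)
  have h2 := S.memH_l2 hg 0 (by omega)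
  simp only [pow_zero, one_mul] at h2 ⊢
  have hL : MemLp (gd 0) 2 P := by rwa [memLp_two_iff_integrable_sq hm]
  rw [variance_eq_sub hL]
  simp [fe, eig_zero E]

lemma Sbound_eq (S : PS P f μ δ β γ J) (E : Eig μ δ β γ φ) (hl : 1 ≤ max m n)
    (hg : MemH P (pq δ β γ) J m n gd) {m' : ℕ} (hm' : m' ≤ m) :
    variance (gd 0) P - Sbound P δ (pq δ β γ) m' n gd =
      ∑ i ∈ range (n + 1), (-1 : ℝ) ^ i * cf δ m' n i * ∫ x, pq δ β γ x ^ i * gd i x ^ 2 ∂P -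
      ∑ i ∈ range (m' + 1), Gm δ m' n i * fe P φ (gd 0) i := by
  rw [S.var_eq E hl hg, Sbound]
  have e1 : ∑ i ∈ Finset.Icc 1 m',
      ((m'.choose i : ℝ) * pp δ ((m' : ℝ) + i) n /
          (fall ((m' : ℝ) + n) i * (∫ x, pq δ β γ x ^ i ∂P) * pp δ ((i : ℝ) - 1) i *
            pp δ (m' : ℝ) n)) *
        (∫ x, pq δ β γ x ^ i * gd i x ∂P) ^ 2 =
      ∑ i ∈ Finset.Icc 1 m', Gm δ m' n i * fe P φ (gd 0) i := by
    refine Finset.sum_congr rfl fun i hi => ?_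
    obtain ⟨h1, h2⟩ := Finset.mem_Icc.1 hi
    rw [S.mean_sq E i gd (fun j hj => S.memH_ftc hg j (by omega))
      (S.memH_int hl hg (by omega)), ← Gm_low S.hδ m' n i h2, Lam_eq_fall]
    have a1 := S.Epos i
    have a2 : 0 < fall (i : ℝ) i := fall_pos le_rfl
    have a3 : 0 < pp δ ((i : ℝ) - 1) i := pp_pos S.hδ (by
      have : (1 : ℝ) ≤ i := by exact_mod_cast h1
      linarith) i
    have a4 : 0 < pp δ (m' : ℝ) n := pp_pos S.hδ (by positivity) n
    have a5 : 0 < fall ((m' : ℝ) + n) i := fall_pos (by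
      have : (i : ℝ) ≤ m' := by exact_mod_cast h2
      have : (0 : ℝ) ≤ n := by positivity
      linarith)
    field_simp
  rw [e1]
  have r : ∀ (N : ℕ) (F : ℕ → ℝ), ∑ i ∈ range (N + 1), F i = F 0 + ∑ i ∈ Finset.Icc 1 N, F i := by
    intro N F
    rw [Finset.range_eq_Ico, Finset.sum_eq_sum_Ico_succ_bot (by omega)]
    congr 1
  rw [r, r, cf_zero, Gm_zero]
  have e2 : ∑ i ∈ Finset.Icc 1 n, (-1 : ℝ) ^ i * cf δ m' n i * ∫ x, pq δ β γ x ^ i * gd i x ^ 2 ∂P =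
      - ∑ i ∈ Finset.Icc 1 n, (-1 : ℝ) ^ (i - 1) *
          ((n.choose i : ℝ) / (fall ((m' : ℝ) + n) i * pp δ (m' : ℝ) i)) *
        ∫ x, pq δ β γ x ^ i * (gd i x) ^ 2 ∂P := by
    rw [← Finset.sum_neg_distrib]
    refine Finset.sum_congr rfl fun i hi => ?_
    obtain ⟨j, rfl⟩ : ∃ j, i = j + 1 := ⟨i - 1, by have := Finset.mem_Icc.1 hi; omega⟩
    rw [Nat.add_sub_cancel, cf, pow_succ]
    ring
  rw [e2]
  simp only [pow_zero, one_mul]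
  ring

lemma hasSum_V (S : PS P f μ δ β γ J) (E : Eig μ δ β γ φ) (hl : 1 ≤ max m n)
    (hg : MemH P (pq δ β γ) J m n gd) {m' : ℕ} (hm' : m' ≤ m) :
    HasSum (fun k => Vm δ m' n k * fe P φ (gd 0) k)
      ((-1) ^ n * Dc δ m' n * (variance (gd 0) P - Sbound P δ (pq δ β γ) m' n gd)) := by
  have h1 : HasSum (fun k => ∑ i ∈ range (n + 1), (-1 : ℝ) ^ i * cf δ m' n i *
      (Lam δ k i * fe P φ (gd 0) k))
      (∑ i ∈ range (n + 1), (-1 : ℝ) ^ i * cf δ m' n i * ∫ x, pq δ β γ x ^ i * gd i x ^ 2 ∂P) :=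
    hasSum_sum fun i hi => (S.parseval E hl hg
      (by have := Finset.mem_range.1 hi; omega)).mul_left _
  have h2 : HasSum (fun k => Gm δ m' n k * fe P φ (gd 0) k)
      (∑ i ∈ range (n + 1), (-1 : ℝ) ^ i * cf δ m' n i * ∫ x, pq δ β γ x ^ i * gd i x ^ 2 ∂P) := by
    refine (congrArg (fun F => HasSum F _) (funext fun k => ?_)).mpr h1
    rw [Gm, Finset.sum_mul]
    exact Finset.sum_congr rfl fun i _ => by ring
  rw [S.Sbound_eq E hl hg hm']
  rw [← hasSum_nat_add_iff' (m' + 1)] at h2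
  have h3 := h2.mul_left ((-1) ^ n * Dc δ m' n)
  have hz : ∑ k ∈ range (m' + 1), Vm δ m' n k * fe P φ (gd 0) k = 0 :=
    Finset.sum_eq_zero fun k hk => by
      rw [Vm_zero δ (by have := Finset.mem_range.1 hk; omega), zero_mul]
  rw [← hasSum_nat_add_iff' (m' + 1), hz, sub_zero]
  refine (congrArg (fun F => HasSum F _) (funext fun k => ?_)).mpr h3
  rw [← Vm_Gm S.hδ m' n _ (by omega), mul_assoc]

lemma poly_iff (S : PS P f μ δ β γ J) (E : Eig μ δ β γ φ) (hl : 1 ≤ max m n)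
    (hg : MemH P (pq δ β γ) J m n gd) (N : ℕ) :
    (∀ k, N < k → fe P φ (gd 0) k = 0) ↔ IsPolyOn (gd 0) J N := by
  have := S.prob
  have hcont : ContinuousOn (gd 0) J := FTC.continuousOn S.Jc S.Jo (S.memH_ftc hg 0 (by omega))
  constructor
  · intro h
    have hI0 : ∀ p : ℝ[X], Integrable (fun x => gd 0 x * p.eval x) P := fun p => by
      simpa using S.memH_intn hl hg 0 (by omega) p
    have pint : ∀ p r : ℝ[X], Integrable (fun x => p.eval x * r.eval x) P := fun p r => by
      simpa using S.qpow_poly2 0 p r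
    set c : ℕ → ℝ := fun k => (∫ x, gd 0 x * (φ k).eval x ∂P) /
      ∫ x, (φ k).eval x * (φ k).eval x ∂P with hc
    set p : ℝ[X] := ∑ k ∈ range (N + 1), C (c k) * φ k with hp
    have hL : MemLp (fun x => gd 0 x - p.eval x) 2 P := by
      have hm := S.memH_aesm hl hg 0 (by omega)
      have h2 := S.memH_l2 hg 0 (by omega)
      simp only [pow_zero, one_mul] at h2
      have a : MemLp (gd 0) 2 P := by rwa [memLp_two_iff_integrable_sq hm]
      have b : MemLp (fun x => p.eval x) 2 P := by
        rw [memLp_two_iff_integrable_sq (by fun_prop)]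
        exact (S.poly (p ^ 2)).congr (ae_of_all _ fun x => by simp)
      exact a.sub b
    have hz : ∀ k, ∫ x, (gd 0 x - p.eval x) * (φ k).eval x ∂P = 0 := by
      intro k
      simp only [sub_mul]
      rw [integral_sub (hI0 _) (pint _ _)]
      have e : ∀ x, p.eval x * (φ k).eval x =
          ∑ j ∈ range (N + 1), c j * ((φ j).eval x * (φ k).eval x) := by
        intro x
        rw [hp, eval_finsetSum, Finset.sum_mul]
        exact Finset.sum_congr rfl fun j _ => by simp; ring
      simp only [e]
      rw [integral_finsetSum _ fun j _ => (pint _ _).const_mul _]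
      simp only [integral_const_mul]
      have hN := S.norm_pos E k
      by_cases hk : k ∈ range (N + 1)
      · rw [Finset.sum_eq_single_of_mem k hk fun j _ hj => by rw [S.orth E hj, mul_zero]]
        simp only [hc]
        rw [div_mul_cancel₀ _ hN.ne', sub_self]
      · have h0 := h k (by rw [Finset.mem_range] at hk; omega)
        rw [Finset.sum_eq_zero fun j hj => by
          rw [S.orth E (show j ≠ k by rintro rfl; exact hk hj), mul_zero]]
        rw [fe, div_eq_zero_iff] at h0
        have := h0.resolve_right hN.ne'
        rw [pow_eq_zero_iff (by norm_num)] at this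
        rw [this, sub_zero]
    have hpar := parseval_poly (ν := P) (ψ := φ) S.poly (fun k => (E.deg k).le)
      (fun k => by
        have := E.monic k
        rw [Monic, leadingCoeff, E.deg] at this
        rw [this]; exact one_ne_zero)
      (fun k l hkl => S.orth E hkl) (fun k => S.norm_pos E k)
      (fun h hm h2 h0 => S.complete hm h2 h0) hL.1
      ((memLp_two_iff_integrable_sq hL.1).1 hL)
    simp only [hz] at hpar
    have h0 : ∫ x, (gd 0 x - p.eval x) ^ 2 ∂P = 0 := by
      refine hpar.unique ?_
      simpa using (hasSum_zero : HasSum (fun _ : ℕ => (0 : ℝ)) 0)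
    rw [integral_eq_zero_iff_of_nonneg (fun x => sq_nonneg _)
      ((memLp_two_iff_integrable_sq hL.1).1 hL)] at h0
    refine ⟨p, ?_, S.ae_eq_on hcont (by fun_prop) ?_⟩
    · refine natDegree_sum_le_of_forall_le _ _ fun k hk => ?_
      refine (natDegree_C_mul_le _ _).trans ?_
      rw [E.deg]
      have := Finset.mem_range.1 hk
      omega
    · filter_upwards [h0] with x hx
      have := pow_eq_zero_iff (two_ne_zero) |>.1 hx
      linarith
  · rintro ⟨p, hp, hpe⟩ k hk
    have e : ∫ x, gd 0 x * (φ k).eval x ∂P = ∫ x, p.eval x * (φ k).eval x ∂P := by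
      refine integral_congr_ae ?_
      filter_upwards [S.aeJ] with x hx
      rw [hpe x hx]
    rw [fe, e, S.low_orth E (lt_of_le_of_lt hp hk)]
    simp

end PS

lemma pearson_core {P : Measure ℝ} {f : ℝ → ℝ} {μ δ β γ : ℝ} {J : Set ℝ}
    (S : PS P f μ δ β γ J)
    (n : ℕ) (hn : 1 ≤ n) (m₁ m₂ : ℕ) (hm : m₁ < m₂) (gd : ℕ → ℝ → ℝ)
    (hg : MemH P (pq δ β γ) J m₂ n gd) :
    1 < zeta δ m₁ m₂ n ∧
    zeta δ m₁ m₂ n * |variance (gd 0) P - Sbound P δ (pq δ β γ) m₂ n gd| ≤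
      |variance (gd 0) P - Sbound P δ (pq δ β γ) m₁ n gd| ∧
    (|variance (gd 0) P - Sbound P δ (pq δ β γ) m₁ n gd| =
        zeta δ m₁ m₂ n * |variance (gd 0) P - Sbound P δ (pq δ β γ) m₂ n gd| ↔
      IsPolyOn (gd 0) J (n + m₁)) := by
  have hl : 1 ≤ max m₂ n := by omega
  obtain ⟨φ, E⟩ := exists_Eig (μ := μ) (β := β) (γ := γ) S.hδ
  have hδ := S.hδ
  have s1 := S.hasSum_V E hl hg hm.le
  have s2 := S.hasSum_V E hl hg le_rfl
  set v1 := variance (gd 0) P - Sbound P δ (pq δ β γ) m₁ n gd with hv1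
  set v2 := variance (gd 0) P - Sbound P δ (pq δ β γ) m₂ n gd with hv2
  have D1 := Dc_pos hδ m₁ n
  have D2 := Dc_pos hδ m₂ n
  set T1 := (-1) ^ n * Dc δ m₁ n * v1 with hT1
  set T2 := (-1) ^ n * Dc δ m₂ n * v2 with hT2
  have n1 : 0 ≤ T1 := s1.nonneg fun k => mul_nonneg (Vm_nonneg hδ _ _ _) (S.fe_nonneg E _ _)
  have n2 : 0 ≤ T2 := s2.nonneg fun k => mul_nonneg (Vm_nonneg hδ _ _ _) (S.fe_nonneg E _ _)
  have a1 : |v1| = T1 / Dc δ m₁ n := by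
    rw [eq_div_iff D1.ne', ← abs_of_nonneg n1, hT1, abs_mul, abs_mul, abs_pow, abs_neg, abs_one,
      one_pow, one_mul, abs_of_pos D1, mul_comm]
  have a2 : zeta δ m₁ m₂ n * |v2| = T2 / Dc δ m₁ n := by
    have : Dc δ m₂ n * |v2| = T2 := by
      rw [← abs_of_nonneg n2, hT2, abs_mul, abs_mul, abs_pow, abs_neg, abs_one,
        one_pow, one_mul, abs_of_pos D2]
    rw [zeta_eq, ← this]; ring
  have s3 := s1.sub s2
  have hnn : ∀ k, 0 ≤ Vm δ m₁ n k * fe P φ (gd 0) k - Vm δ m₂ n k * fe P φ (gd 0) k := fun k => by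
    rw [← sub_mul]
    exact mul_nonneg (sub_nonneg.2 (Vm_le hδ hn hm k)) (S.fe_nonneg E _ _)
  have hle : 0 ≤ T1 - T2 := s3.nonneg hnn
  refine ⟨?_, ?_, ?_⟩
  · rw [zeta_eq, one_lt_div D1]; exact Dc_lt hδ hn hm
  · rw [a1, a2]
    exact div_le_div_of_nonneg_right (by linarith) D1.le
  · rw [a1, a2, div_left_inj' D1.ne', ← S.poly_iff E hl hg]
    constructor
    · intro h k hk
      rw [h, sub_self] at s3
      have := (hasSum_zero_iff_of_nonneg hnn).1 s3
      have hk' := congrFun this k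
      simp only [Pi.zero_apply] at hk'
      rw [← sub_mul] at hk'
      have hlt := Vm_lt hδ hn hm (show m₁ + n < k by omega)
      exact (mul_eq_zero.1 hk').resolve_left (by linarith)
    · intro h
      refine s1.unique ((congrArg (fun F => HasSum F _) (funext fun k => ?_)).mpr s2)
      rcases le_or_gt k (m₁ + n) with hk | hk
      · rw [Vm_zero δ hk, Vm_zero δ (by omega)]
      · rw [h k (by omega)]; simp
end E4

/-- **Theorem 3.1.** If `X ∼ IP(μ; δ, β, γ)` with `δ ≤ 0`, `n ≥ 1`,
`0 ≤ m₁ < m₂` and `g ∈ H^{m₂,n}(X)`, then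
`|Var g(X) − S_{m₁,n}(g)| ≥ ζ_{m₁,m₂,n}(δ) |Var g(X) − S_{m₂,n}(g)|` with
`ζ_{m₁,m₂,n}(δ) > 1`, and equality holds iff `g` coincides on the support of `X`
with a polynomial of degree at most `n + m₁`. -/
theorem pearson_bound_comparison
    (P : Measure ℝ) (f : ℝ → ℝ) (μ δ β γ : ℝ) (hδ : δ ≤ 0)
    (hIP : IsIntegratedPearson P f μ δ β γ)
    (α ω : EReal) (hsupp : {x : ℝ | 0 < f x} = erealIoo α ω)
    (n : ℕ) (hn : 1 ≤ n) (m₁ m₂ : ℕ) (hm : m₁ < m₂) (gd : ℕ → ℝ → ℝ)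
    (hg : MemH P (pq δ β γ) (erealIoo α ω) m₂ n gd) :
    1 < zeta δ m₁ m₂ n ∧
    zeta δ m₁ m₂ n * |variance (gd 0) P - Sbound P δ (pq δ β γ) m₂ n gd| ≤
      |variance (gd 0) P - Sbound P δ (pq δ β γ) m₁ n gd| ∧
    (|variance (gd 0) P - Sbound P δ (pq δ β γ) m₁ n gd| =
        zeta δ m₁ m₂ n * |variance (gd 0) P - Sbound P δ (pq δ β γ) m₂ n gd| ↔
      IsPolyOn (gd 0) (erealIoo α ω) (n + m₁)) := by
  exact pearson_core (PS.of_IP hδ hIP hsupp) n hn m₁ m₂ hm gd hg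

end
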